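/- arXiv:1607.01324 — 2 statements merged into one kernel-verified Lean document; each statement's English description precedes it below -/
import Mathlib

section
/- Let (Λ, ξ) be a decorated D-lattice of dimension N ≡ 4 (mod 8). If v ∈ Λ is hyperelliptic (v² = -4, div(v) = 2, v* = ξ) and w ∈ Λ is unigonal (w² = -2, div(w) = 2), spanning a negative definite sublattice, then |(v,w)| = 2, the sublattice ⟨v,w⟩ is isomorphic to D₂ (with standard basis {v+w, w} after possibly replacing w by -w), and Λ = ⟨v,w⟩ ⊕ ⟨v,w⟩^⊥ with ⟨v,w⟩^⊥ ≅ II_{2,N-2}. -/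
noncomputable section

open scoped BigOperators

/-- `x` has integer entries. -/
def IntVec {n : ℕ} (x : Fin n → ℚ) : Prop := ∀ i, ∃ a : ℤ, x i = (a : ℚ)

/-- The lattice `D_n = {x ∈ ℤⁿ : Σ xᵢ ≡ 0 mod 2}` (viewed inside `ℚⁿ`),
equipped with the negative of the Euclidean form `negE`. -/
def DSet (n : ℕ) : Set (Fin n → ℚ) :=
  {x | IntVec x ∧ ∃ a : ℤ, (∑ i, x i) = 2 * (a : ℚ)}

/-- The negative of the standard Euclidean bilinear form. -/
def negE {n : ℕ} (x y : Fin n → ℚ) : ℚ := - ∑ i, x i * y i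

/-- The vector `(1/2, …, 1/2)`. -/
def halfVec (n : ℕ) : Fin n → ℚ := fun _ => 1/2

/-- The lattice `Λ_N = U² ⊕ D_{N-2}` realized inside `ℚ^{N+2}`: integral vectors whose
coordinates of index `≥ 4` have even sum.  The first four coordinates carry the two
hyperbolic planes. -/
def LamSet (N : ℕ) : Set (Fin (N + 2) → ℚ) :=
  {x | IntVec x ∧ ∃ a : ℤ, (∑ i : Fin (N + 2), if 4 ≤ (i : ℕ) then x i else 0) = 2 * (a : ℚ)}

/-- The bilinear form of `Λ_N = U² ⊕ D_{N-2}`. -/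
def LamForm (N : ℕ) (x y : Fin (N + 2) → ℚ) : ℚ :=
  x 0 * y 1 + x 1 * y 0 + x 2 * y 3 + x 3 * y 2
    - ∑ i : Fin (N + 2), (if 4 ≤ (i : ℕ) then x i * y i else 0)

/-- The (negative definite) `E₈` lattice inside `ℚ⁸`: vectors that are integral or
half-integral, with even coordinate sum; the form is `negE`. -/
def E8Set : Set (Fin 8 → ℚ) :=
  {x | (IntVec x ∨ IntVec (x - halfVec 8)) ∧ ∃ a : ℤ, (∑ i, x i) = 2 * (a : ℚ)}

/-- Ambient space for the even unimodular lattice `II_{2,2+8k} = U² ⊕ E₈^k`. -/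
abbrev IIAmb (k : ℕ) := (Fin 4 → ℚ) × (Fin k → Fin 8 → ℚ)

/-- The form of `U²` on `ℚ⁴`. -/
def UForm (x y : Fin 4 → ℚ) : ℚ := x 0 * y 1 + x 1 * y 0 + x 2 * y 3 + x 3 * y 2

/-- The bilinear form of `II_{2,2+8k} = U² ⊕ E₈^k`. -/
def IIForm (k : ℕ) (x y : IIAmb k) : ℚ := UForm x.1 y.1 + ∑ j, negE (x.2 j) (y.2 j)

/-- The even unimodular lattice `II_{2,2+8k} = U² ⊕ E₈^k` inside its ambient space. -/
def IISet (k : ℕ) : Set (IIAmb k) := {p | IntVec p.1 ∧ ∀ j, p.2 j ∈ E8Set}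

/-- `v` has divisibility `d` in `Λ_N`: all pairings with lattice vectors are divisible
by `d`, and `d` is attained. -/
def HasDiv (N : ℕ) (v : Fin (N + 2) → ℚ) (d : ℤ) : Prop :=
  (∀ x ∈ LamSet N, ∃ a : ℤ, LamForm N v x = (d : ℚ) * a) ∧
  ∃ x ∈ LamSet N, LamForm N v x = (d : ℚ)

/-- `ξ` represents a decoration of `Λ_N`: an element of the dual lattice whose class in
the discriminant group has square `1` modulo `2ℤ`. -/
def IsDeco (N : ℕ) (ξ : Fin (N + 2) → ℚ) : Prop :=
  (∀ y ∈ LamSet N, ∃ a : ℤ, LamForm N ξ y = (a : ℚ)) ∧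
  ∃ a : ℤ, LamForm N ξ ξ = 1 + 2 * (a : ℚ)


/-! ### Eichler transvections -/

section Eichler

variable {V : Type*} [AddCommGroup V] [Module ℚ V]

/-- A lattice isometry: preserves the form and the lattice. -/
def IsIso (B : V →ₗ[ℚ] V →ₗ[ℚ] ℚ) (L : AddSubgroup V) (d : V) (g : V ≃ₗ[ℚ] V) : Prop :=
  (∀ x y, B (g x) (g y) = B x y) ∧ (∀ x, g x ∈ L ↔ x ∈ L) ∧ g d = d

lemma IsIso.trans {B : V →ₗ[ℚ] V →ₗ[ℚ] ℚ} {L : AddSubgroup V} {d : V} {g h : V ≃ₗ[ℚ] V}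
    (hg : IsIso B L d g) (hh : IsIso B L d h) : IsIso B L d (g.trans h) := by
  refine ⟨fun x y => ?_, fun x => ?_, ?_⟩
  · simp [hg.1, hh.1]
  · simp [hg.2.1, hh.2.1]
  · simp [hg.2.2, hh.2.2]

/-- The transvection as a linear map. -/
def tvMap (B : V →ₗ[ℚ] V →ₗ[ℚ] ℚ) (e c : V) : V →ₗ[ℚ] V :=
  LinearMap.id + (B e).smulRight c - (B c).smulRight e - (B e).smulRight ((B c c / 2) • e)

lemma tvMap_apply (B : V →ₗ[ℚ] V →ₗ[ℚ] ℚ) (e c x : V) :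
    tvMap B e c x = x + B e x • c - B c x • e - B e x • (B c c / 2) • e := by
  simp [tvMap]

lemma tvMap_inv (B : V →ₗ[ℚ] V →ₗ[ℚ] ℚ) (hs : ∀ x y, B x y = B y x) (e c : V)
    (he : B e e = 0) (hec : B e c = 0) (x : V) : tvMap B e (-c) (tvMap B e c x) = x := by
  have hce : B c e = 0 := by rw [hs, hec]
  simp only [tvMap_apply, map_add, map_sub, map_smul, map_neg, LinearMap.neg_apply, he, hec, hce]
  module

/-- The transvection as a linear equivalence. -/
def tv (B : V →ₗ[ℚ] V →ₗ[ℚ] ℚ) (hs : ∀ x y, B x y = B y x) (e c : V)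
    (he : B e e = 0) (hec : B e c = 0) : V ≃ₗ[ℚ] V :=
  { tvMap B e c with
    invFun := tvMap B e (-c)
    left_inv := fun x => tvMap_inv B hs e c he hec x
    right_inv := fun x => by
      have := tvMap_inv B hs e (-c) he (by simp [hec]) x
      rwa [neg_neg] at this }

lemma tv_apply (B : V →ₗ[ℚ] V →ₗ[ℚ] ℚ) (hs : ∀ x y, B x y = B y x) (e c : V)
    (he : B e e = 0) (hec : B e c = 0) (x : V) :
    tv B hs e c he hec x = x + B e x • c - B c x • e - B e x • (B c c / 2) • e :=
  tvMap_apply B e c x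

lemma zsmul_mem_q (L : AddSubgroup V) {x : V} (hx : x ∈ L) {q : ℚ} (n : ℤ) (h : q = n) :
    q • x ∈ L := by
  rw [h, Int.cast_smul_eq_zsmul]
  exact L.zsmul_mem hx n

lemma tv_mem (B : V →ₗ[ℚ] V →ₗ[ℚ] ℚ) (L : AddSubgroup V)
    (hIntg : ∀ x ∈ L, ∀ y ∈ L, ∃ n : ℤ, B x y = n)
    (hev : ∀ x ∈ L, ∃ n : ℤ, B x x = 2 * (n : ℚ)) (e c : V) (heL : e ∈ L) (hcL : c ∈ L)
    (x : V) (hx : x ∈ L) : tvMap B e c x ∈ L := by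
  rw [tvMap_apply]
  obtain ⟨n, hn⟩ := hIntg e heL x hx
  obtain ⟨m, hm⟩ := hIntg c hcL x hx
  obtain ⟨l, hl⟩ := hev c hcL
  refine L.sub_mem (L.sub_mem (L.add_mem hx (zsmul_mem_q L hcL n hn)) (zsmul_mem_q L heL m hm))
    (zsmul_mem_q L (zsmul_mem_q L heL l ?_) n hn)
  rw [hl]; ring

lemma tv_isIso (B : V →ₗ[ℚ] V →ₗ[ℚ] ℚ) (hs : ∀ x y, B x y = B y x) (L : AddSubgroup V)
    (hIntg : ∀ x ∈ L, ∀ y ∈ L, ∃ n : ℤ, B x y = n)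
    (hev : ∀ x ∈ L, ∃ n : ℤ, B x x = 2 * (n : ℚ)) (d e c : V) (heL : e ∈ L) (hcL : c ∈ L)
    (he : B e e = 0) (hec : B e c = 0) (hed : B e d = 0) (hcd : B c d = 0) :
    IsIso B L d (tv B hs e c he hec) := by
  have hce : B c e = 0 := by rw [hs, hec]
  refine ⟨fun x y => ?_, fun x => ⟨fun h => ?_, fun h => ?_⟩, ?_⟩
  · simp only [tv_apply, map_add, map_sub, map_smul, LinearMap.add_apply, LinearMap.sub_apply,
      LinearMap.smul_apply, he, hec, hce, smul_eq_mul, hs x e, hs x c]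
    ring
  · have := tv_mem B L hIntg hev e (-c) heL (L.neg_mem hcL) _ h
    rwa [show tvMap B e (-c) (tv B hs e c he hec x) = x from tvMap_inv B hs e c he hec x] at this
  · exact tv_mem B L hIntg hev e c heL hcL x h
  · simp [tv_apply, hed, hcd]

lemma exists_shift (p r : ℤ) (hr : r ≠ 0) : ∃ n : ℤ, 0 < p + n * r ∧ p + n * r ≤ |r| := by
  refine ⟨-((p - 1) / r), ?_, ?_⟩
  · have := Int.emod_nonneg (p - 1) hr
    have h2 := Int.mul_ediv_add_emod (p - 1) r
    nlinarith
  · have := Int.emod_lt_abs (p - 1) hr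
    have h2 := Int.mul_ediv_add_emod (p - 1) r
    nlinarith

/-- Orbit-minimality argument: divisibility from minimality. -/
lemma eichler (B : V →ₗ[ℚ] V →ₗ[ℚ] ℚ) (hs : ∀ x y, B x y = B y x) (L : AddSubgroup V)
    (hIntg : ∀ x ∈ L, ∀ y ∈ L, ∃ n : ℤ, B x y = n)
    (hev : ∀ x ∈ L, ∃ n : ℤ, B x x = 2 * (n : ℚ)) (d e₁ f₁ e₂ f₂ a w : V)
    (he₁ : e₁ ∈ L) (hf₁ : f₁ ∈ L) (he₂ : e₂ ∈ L) (hf₂ : f₂ ∈ L) (ha : a ∈ L)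
    (e11 : B e₁ e₁ = 0) (f11 : B f₁ f₁ = 0) (ef1 : B e₁ f₁ = 1)
    (e22 : B e₂ e₂ = 0) (f22 : B f₂ f₂ = 0)
    (e12 : B e₁ e₂ = 0) (ef12 : B e₁ f₂ = 0) (fe12 : B f₁ e₂ = 0) (ff12 : B f₁ f₂ = 0)
    (ef2 : B e₂ f₂ = 1)
    (ae1 : B a e₁ = 0) (af1 : B a f₁ = 0)
    (de1 : B d e₁ = 0) (df1 : B d f₁ = 0) (de2 : B d e₂ = 0) (df2 : B d f₂ = 0)
    (da : B d a = 0) (dw : B d w = 0)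
    (haa : B a a = -2) (hww : B w w = -2)
    (hadiv : ∀ x ∈ L, ∃ n : ℤ, B a x = 2 * (n : ℚ))
    (hwa : ∃ l ∈ L, w = a + (2 : ℚ) • l) :
    ∃ g : V ≃ₗ[ℚ] V, IsIso B L d g ∧ g w = a := by
  have T := tv_isIso B hs L hIntg hev d
  have hwL : w ∈ L := by
    obtain ⟨l, hl, rfl⟩ := hwa
    exact L.add_mem ha (zsmul_mem_q L hl 2 (by norm_num))
  have hwdiv : ∀ x ∈ L, ∃ n : ℤ, B w x = 2 * (n : ℚ) := by
    intro x hx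
    obtain ⟨l, hl, rfl⟩ := hwa
    obtain ⟨n, hn⟩ := hadiv x hx
    obtain ⟨m, hm⟩ := hIntg l hl x hx
    refine ⟨n + m, ?_⟩
    simp [hn, hm]; ring
  let O : V → Prop := fun x => (∃ g : V ≃ₗ[ℚ] V, IsIso B L d g ∧ g w = x) ∧
    ∃ l ∈ L, x = a + (2 : ℚ) • l
  have hOw : O w := ⟨⟨LinearEquiv.refl ℚ V, ⟨fun _ _ => rfl, fun _ => Iff.rfl, rfl⟩, rfl⟩, hwa⟩
  have hOdiv : ∀ x, O x → ∀ y ∈ L, ∃ n : ℤ, B y x = 2 * (n : ℚ) := by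
    rintro x ⟨⟨g, hg, rfl⟩, -⟩ y hy
    have : g.symm y ∈ L := by rw [← hg.2.1]; simpa using hy
    obtain ⟨n, hn⟩ := hwdiv _ this
    refine ⟨n, ?_⟩
    rw [← hn, ← hg.1 w (g.symm y), LinearEquiv.apply_symm_apply, hs]
  have hOtv : ∀ x, O x → ∀ e c, e ∈ L → c ∈ L → B e e = 0 → B e c = 0 → B e d = 0 → B c d = 0 →
      O (x + B e x • c - B c x • e - B e x • (B c c / 2) • e) := by
    intro x hx e c he hc h1 h2 h3 h4
    obtain ⟨n, hn⟩ := hOdiv x hx e he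
    obtain ⟨m, hm⟩ := hOdiv x hx c hc
    obtain ⟨k, hk⟩ := hev c hc
    obtain ⟨⟨g, hg, rfl⟩, l, hl, hxl⟩ := hx
    refine ⟨⟨g.trans (tv B hs e c h1 h2), hg.trans (T e c he hc h1 h2 h3 h4), ?_⟩,
      l + (n : ℚ) • c - (m : ℚ) • e - (n : ℚ) • (k : ℚ) • e, ?_, ?_⟩
    · rw [LinearEquiv.trans_apply, tv_apply]
    · exact L.sub_mem (L.sub_mem (L.add_mem hl (zsmul_mem_q L hc n rfl))
        (zsmul_mem_q L he m rfl)) (zsmul_mem_q L (zsmul_mem_q L he k rfl) n rfl)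
    · rw [hn, hm, hk, hxl]; module
  have hOL : ∀ x, O x → x ∈ L := by
    rintro x ⟨⟨g, hg, rfl⟩, -⟩; exact (hg.2.1 w).2 hwL
  have hOd : ∀ x, O x → B d x = 0 := by
    rintro x ⟨⟨g, hg, rfl⟩, -⟩
    rw [← dw, ← hg.1 d w, hg.2.2]
  have hOn : ∀ x, O x → B x x = -2 := by
    rintro x ⟨⟨g, hg, rfl⟩, -⟩
    rw [hg.1, hww]
  have fe1 : B f₁ e₁ = 1 := by rw [hs, ef1]
  have fe2 : B f₂ e₂ = 1 := by rw [hs, ef2]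
  have e21 : B e₂ e₁ = 0 := by rw [hs, e12]
  have fe21 : B f₂ e₁ = 0 := by rw [hs, ef12]
  have ef21 : B e₂ f₁ = 0 := by rw [hs, fe12]
  have ff21 : B f₂ f₁ = 0 := by rw [hs, ff12]
  have e1d : B e₁ d = 0 := by rw [hs, de1]
  have f1d : B f₁ d = 0 := by rw [hs, df1]
  have e2d : B e₂ d = 0 := by rw [hs, de2]
  have f2d : B f₂ d = 0 := by rw [hs, df2]
  have mulL : ∀ (n : ℤ) x, x ∈ L → (n : ℚ) • x ∈ L := fun n x hx => zsmul_mem_q L hx n rfl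
  have addp : ∀ z, z ∈ L → B z z = 0 → B z e₁ = 0 → B z f₁ = 0 → B z d = 0 → ∀ x, O x → ∀ n : ℤ,
      ∃ y, O y ∧ B f₁ y = B f₁ x + n * B z x := by
    intro z hz h0 h1 h2 h3 x hx n
    refine ⟨_, hOtv x hx z ((n : ℚ) • e₁) hz (mulL n _ he₁) h0 (by simp [h1]) h3
      (by simp [e1d]), ?_⟩
    have h2' : B f₁ z = 0 := by rw [hs, h2]
    simp [h2', fe1, e11]; ring
  have hex : ∃ x, O x ∧ B f₁ x ≠ 0 := by
    by_contra! hcon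
    have key : ∀ z, z ∈ L → B z z = 0 → B z e₁ = 0 → B z f₁ = 0 → B z d = 0 → ∀ x, O x →
        B z x = 0 := by
      intro z hz h0 h1 h2 h3 x hx
      obtain ⟨y, hy, hyx⟩ := addp z hz h0 h1 h2 h3 x hx 1
      rw [hcon y hy, hcon x hx] at hyx
      simpa using hyx.symm
    have h2 := key e₂ he₂ e22 e21 ef21 e2d w hOw
    have h3 := key f₂ hf₂ f22 fe21 ff21 f2d w hOw
    have h4 := key f₂ hf₂ f22 fe21 ff21 f2d _
      (hOtv w hOw e₂ w he₂ hwL e22 h2 e2d (by rw [hs, dw]))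
    simp [h2, h3, fe2, hww] at h4
  have hex' : ∃ n : ℕ, n ≠ 0 ∧ ∃ x, O x ∧ ∃ p : ℤ, B f₁ x = p ∧ p.natAbs = n := by
    obtain ⟨x, hx, hne⟩ := hex
    obtain ⟨p, hp⟩ := hIntg f₁ hf₁ x (hOL x hx)
    refine ⟨p.natAbs, ?_, x, hx, p, hp, rfl⟩
    intro h
    rw [Int.natAbs_eq_zero] at h
    apply hne; rw [hp, h]; simp
  classical
  obtain ⟨hm0, x, hx, p, hp, hpn⟩ := Nat.find_spec hex'
  have hmin : ∀ y, O y → ∀ q : ℤ, B f₁ y = q → q ≠ 0 → |p| ≤ |q| := by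
    intro y hy q hq hq0
    have := Nat.find_min' hex' (m := q.natAbs) ⟨by simpa using hq0, y, hy, q, hq, rfl⟩
    rw [← hpn] at this
    rw [Int.abs_eq_natAbs, Int.abs_eq_natAbs]
    exact_mod_cast this
  have hp0 : p ≠ 0 := by
    rintro rfl; apply hm0; rw [← hpn]; rfl
  have hOdef : ∀ x, O x → (∃ g : V ≃ₗ[ℚ] V, IsIso B L d g ∧ g w = x) ∧
    ∃ l ∈ L, x = a + (2 : ℚ) • l := fun x hx => hx
  clear_value O
  clear hpn hm0
  have hdvd : ∀ z z', z ∈ L → z' ∈ L → B z z = 0 → B z' z' = 0 → B z z' = 1 → B z e₁ = 0 →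
      B z f₁ = 0 → B z' f₁ = 0 →
      B z d = 0 → B z' d = 0 → ∀ y, O y → B f₁ y = p → ∀ r : ℤ, B z y = r → p ∣ r := by
    intro z z' hz hz' h0 h0' hzz h1 h2 h2' h3 h3' y hy hyp r hr
    have h2s : B f₁ z' = 0 := by rw [hs, h2']
    have hy' := hOtv y hy f₁ (((-(r / p) : ℤ) : ℚ) • z') hf₁ (mulL _ _ hz') f11 (by simp [h2s]) f1d
      (by simp [h3'])
    set y' := y + B f₁ y • (((-(r / p) : ℤ) : ℚ) • z') -
      B (((-(r / p) : ℤ) : ℚ) • z') y • f₁ - B f₁ y •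
      (B (((-(r / p) : ℤ) : ℚ) • z') (((-(r / p) : ℤ) : ℚ) • z') / 2) • f₁ with hy'def
    have hp' : B f₁ y' = p := by
      simp [hy'def, h2s, f11, hyp]
    have hr' : B z y' = ((r % p : ℤ) : ℚ) := by
      rw [Int.emod_def]
      simp [hy'def, h2, hzz, hyp, hr]; ring
    by_contra hnd
    have hne : r % p ≠ 0 := fun h => hnd (Int.dvd_of_emod_eq_zero h)
    obtain ⟨n, hn1, hn2⟩ := exists_shift p (r % p) hne
    obtain ⟨y'', hy'', heq⟩ := addp z hz h0 h1 h2 h3 y' hy' n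
    have := hmin y'' hy'' (p + n * (r % p)) (by rw [heq, hp', hr']; push_cast; ring) (by omega)
    have h5 := Int.emod_lt_abs r hp0
    have h6 := Int.emod_nonneg r hp0
    rw [abs_of_pos hn1] at this
    rw [abs_of_nonneg h6] at hn2
    omega
  obtain ⟨s, hs1⟩ := hIntg e₂ he₂ x (hOL x hx)
  obtain ⟨t, ht⟩ := hdvd e₂ f₂ he₂ hf₂ e22 f22 ef2 e21 ef21 ff21 e2d f2d x hx hp s hs1
  obtain ⟨y, hy, hyp, hys⟩ : ∃ y, O y ∧ B f₁ y = p ∧ B e₂ y = 0 := by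
    refine ⟨_, hOtv x hx f₁ (((-t : ℤ) : ℚ) • f₂) hf₁ (mulL _ _ hf₂) f11 (by simp [ff12]) f1d
      (by simp [f2d]), ?_, ?_⟩
    · simp [ff12, f11, hp]
    · simp [ef2, ef21, hs1, ht, hp]
  obtain ⟨q, hq⟩ := hOdiv y hy e₁ he₁
  obtain ⟨p', hp'⟩ := hOdiv y hy f₁ hf₁
  have hpp : p = 2 * p' := by
    have : (p : ℚ) = 2 * p' := by rw [← hyp, hp']
    exact_mod_cast this
  have ydL := hOL y hy
  obtain ⟨r, hr⟩ := hIntg f₂ hf₂ y ydL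
  have hpr := hdvd f₂ e₂ hf₂ he₂ f22 e22 fe2 fe21 ff21 ef21 f2d e2d y hy hyp r hr
  have hp2 : p ∣ 2 := by
    have hc : y - (p : ℚ) • e₁ - ((2 * q : ℤ) : ℚ) • f₁ ∈ L :=
      L.sub_mem (L.sub_mem ydL (mulL _ _ he₁)) (mulL _ _ hf₁)
    have hO := hOtv y hy e₂ _ he₂ hc e22 (by simp [hys, e21, ef21]) e2d
      (by simp [e1d, f1d, hs y d, hOd y hy])
    have := hdvd f₂ e₂ hf₂ he₂ f22 e22 fe2 fe21 ff21 ef21 f2d e2d _ hO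
      (by simp [hys, hyp, fe12]) (r + 2 + 4 * p * q) (by
        simp [hys, hyp, fe2, hr, hOn y hy, hq]; ring)
    have h7 : p ∣ r + 4 * p * q := dvd_add hpr ⟨4 * q, by ring⟩
    have h8 := dvd_sub this h7
    have : r + 2 + 4 * p * q - (r + 4 * p * q) = 2 := by ring
    rwa [this] at h8
  have hp22 : p = 2 ∨ p = -2 := by
    have := Int.le_of_dvd (by norm_num) hp2
    have := Int.le_of_dvd (by norm_num) ((neg_dvd).2 hp2)
    omega
  obtain ⟨-, l, hl, hyl⟩ := hOdef y hy
  obtain ⟨ε, hε, hpε⟩ : ∃ ε : ℤ, ε * ε = 1 ∧ p = 2 * ε := by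
    rcases hp22 with h | h
    · exact ⟨1, by norm_num, by rw [h]; norm_num⟩
    · exact ⟨-1, by norm_num, by rw [h]; norm_num⟩
  have hεq : (ε : ℚ) * ε = 1 := by exact_mod_cast hε
  have hpq : (p : ℚ) = 2 * ε := by exact_mod_cast hpε
  have hfl : B f₁ l = ε := by
    have := hyp
    rw [hyl, map_add, map_smul, hs f₁ a, af1, hpq] at this
    simpa using this
  have hdl : B d l = 0 := by
    have := hOd y hy
    rw [hyl, map_add, map_smul, da] at this
    simpa using this
  have hcL : e₁ - (ε : ℚ) • l ∈ L := L.sub_mem he₁ (mulL _ _ hl)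
  have hO1 := hOtv y hy f₁ (e₁ - (ε : ℚ) • l) hf₁ hcL f11
    (by simp [fe1, hfl, hεq]) f1d (by simp [e1d, hs l d, hdl])
  obtain ⟨m, hm⟩ : ∃ m : ℚ, y + B f₁ y • (e₁ - (ε : ℚ) • l) - B (e₁ - (ε : ℚ) • l) y • f₁ -
      B f₁ y • (B (e₁ - (ε : ℚ) • l) (e₁ - (ε : ℚ) • l) / 2) • f₁ =
      a + (2 * ε : ℚ) • e₁ + m • f₁ := by
    refine ⟨- B (e₁ - (ε : ℚ) • l) y -
      2 * ε * (B (e₁ - (ε : ℚ) • l) (e₁ - (ε : ℚ) • l) / 2), ?_⟩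
    generalize B (e₁ - (ε : ℚ) • l) (e₁ - (ε : ℚ) • l) = X
    generalize B (e₁ - (ε : ℚ) • l) y = Y
    rw [hyp, hpq, hyl, smul_sub, smul_smul, show (2 * ε * ε : ℚ) = 2 by rw [mul_assoc, hεq]; ring]
    module
  rw [hm] at hO1
  have hm0 : m = 0 := by
    have h := hOn _ hO1
    simp [ae1, af1, e11, f11, ef1, fe1, haa, hs e₁ a, hs f₁ a] at h
    have h9 : (4 * m) * (ε * ε : ℚ) = 0 := by linear_combination (ε : ℚ) * h
    rw [hεq] at h9
    linarith
  rw [hm0, zero_smul, add_zero] at hO1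
  have hO2 := hOtv _ hO1 e₁ (((-ε : ℤ) : ℚ) • a) he₁ (mulL _ _ ha) e11
    (by simp [hs e₁ a, ae1]) e1d (by simp [hs a d, da])
  have hfin : a + (2 * ε : ℚ) • e₁ + B e₁ (a + (2 * ε : ℚ) • e₁) • (((-ε : ℤ) : ℚ) • a) -
      B (((-ε : ℤ) : ℚ) • a) (a + (2 * ε : ℚ) • e₁) • e₁ -
      B e₁ (a + (2 * ε : ℚ) • e₁) •
      (B (((-ε : ℤ) : ℚ) • a) (((-ε : ℤ) : ℚ) • a) / 2) • e₁ = a := by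
    simp [hs e₁ a, ae1, e11, haa]
    module
  rw [hfin] at hO2
  exact (hOdef a hO2).1

end Eichler

/-! ### The lattice `U² ⊕ E₈^k ⊕ D₂` -/

lemma E8_iff (x : Fin 8 → ℚ) : x ∈ E8Set ↔
    (∃ h : ℤ, ∃ n : Fin 8 → ℤ, ∀ i, x i = n i + (h : ℚ) / 2) ∧ ∃ a : ℤ, (∑ i, x i) = 2 * (a : ℚ) := by
  unfold E8Set
  simp only [Set.mem_ofPred_eq]
  refine and_congr_left fun _ => ⟨?_, ?_⟩
  · rintro (h | h)
    · choose n hn using h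
      exact ⟨0, n, fun i => by simp [hn]⟩
    · choose n hn using h
      refine ⟨1, n, fun i => ?_⟩
      have := hn i
      simp only [Pi.sub_apply, halfVec] at this
      rw [← this]; push_cast; ring
  · rintro ⟨h, n, hn⟩
    obtain ⟨m, rfl | rfl⟩ := Int.even_or_odd' h
    · left; intro i; exact ⟨n i + m, by rw [hn]; push_cast; ring⟩
    · right; intro i; exact ⟨n i + m, by simp only [Pi.sub_apply, halfVec]; rw [hn]; push_cast; ring⟩

lemma E8_pair (x y : Fin 8 → ℚ) (hx : x ∈ E8Set) (hy : y ∈ E8Set) : ∃ n : ℤ, negE x y = n := by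
  obtain ⟨⟨h, n, hn⟩, a, ha⟩ := (E8_iff x).1 hx
  obtain ⟨⟨h', n', hn'⟩, a', ha'⟩ := (E8_iff y).1 hy
  simp only [hn, hn', Finset.sum_add_distrib] at ha ha'
  simp at ha ha'
  refine ⟨-(∑ i, n i * n' i + h' * (a - 2 * h) + h * (a' - 2 * h') + 2 * h * h'), ?_⟩
  simp only [negE, hn, hn']
  have : ∑ i, ((n i : ℚ) + h / 2) * (n' i + h' / 2) =
      ∑ i, (n i : ℚ) * n' i + (h' / 2) * ∑ i, (n i : ℚ) + (h / 2) * ∑ i, (n' i : ℚ)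
      + 2 * h * h' := by
    simp only [Fin.sum_univ_eight]; ring
  rw [this]
  push_cast
  linear_combination (-(h' : ℚ) / 2) * ha + (-(h : ℚ) / 2) * ha'

lemma E8_even (x : Fin 8 → ℚ) (hx : x ∈ E8Set) : ∃ n : ℤ, negE x x = 2 * (n : ℚ) := by
  obtain ⟨⟨h, n, hn⟩, a, ha⟩ := (E8_iff x).1 hx
  simp only [hn, Finset.sum_add_distrib] at ha
  simp at ha
  have h1 : ∑ i, n i = 2 * (a - 2 * h) := by
    have : ((∑ i, n i : ℤ) : ℚ) = ((2 * (a - 2 * h) : ℤ) : ℚ) := by push_cast; linarith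
    exact_mod_cast this
  have h2 : ∃ b : ℤ, ∑ i, n i * n i = 2 * b := by
    choose c hc using fun i => Int.even_mul_pred_self (n i)
    refine ⟨∑ i, c i + (a - 2 * h), ?_⟩
    rw [mul_add, ← h1, Finset.mul_sum, ← Finset.sum_add_distrib]
    refine Finset.sum_congr rfl fun i _ => ?_
    linarith [hc i]
  obtain ⟨b, hb⟩ := h2
  refine ⟨-(b + h * (a - 2 * h) + h * h), ?_⟩
  simp only [negE, hn]
  have : ∑ i, ((n i : ℚ) + h / 2) * (n i + h / 2) =
      ∑ i, (n i : ℚ) * n i + h * ∑ i, (n i : ℚ) + 2 * h * h := by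
    simp only [Fin.sum_univ_eight]; ring
  have hbq : ∑ i, (n i : ℚ) * n i = 2 * b := by exact_mod_cast hb
  have h1q : ∑ i, (n i : ℚ) = 2 * (a - 2 * h) := by exact_mod_cast h1
  rw [this, hbq, h1q]
  push_cast
  ring

lemma E8_add (x y : Fin 8 → ℚ) (hx : x ∈ E8Set) (hy : y ∈ E8Set) : x + y ∈ E8Set := by
  rw [E8_iff] at *
  obtain ⟨⟨h, n, hn⟩, a, ha⟩ := hx
  obtain ⟨⟨h', n', hn'⟩, a', ha'⟩ := hy
  refine ⟨⟨h + h', n + n', fun i => ?_⟩, a + a', ?_⟩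
  · simp [hn, hn']; ring
  · simp [Finset.sum_add_distrib, ha, ha']; ring

lemma E8_neg (x : Fin 8 → ℚ) (hx : x ∈ E8Set) : -x ∈ E8Set := by
  rw [E8_iff] at *
  obtain ⟨⟨h, n, hn⟩, a, ha⟩ := hx
  refine ⟨⟨-h, -n, fun i => ?_⟩, -a, ?_⟩
  · simp [hn]; ring
  · simp [ha]

lemma E8_zero : (0 : Fin 8 → ℚ) ∈ E8Set := by
  rw [E8_iff]
  exact ⟨⟨0, 0, by simp⟩, 0, by simp⟩

lemma negE_add_left {n : ℕ} (x y z : Fin n → ℚ) : negE (x + y) z = negE x z + negE y z := by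
  simp only [negE, Pi.add_apply, add_mul, Finset.sum_add_distrib]; ring

lemma negE_smul_left {n : ℕ} (c : ℚ) (x z : Fin n → ℚ) : negE (c • x) z = c * negE x z := by
  simp only [negE, Pi.smul_apply, smul_eq_mul, mul_assoc, ← Finset.mul_sum]; ring

lemma negE_comm {n : ℕ} (x z : Fin n → ℚ) : negE x z = negE z x := by
  simp only [negE, mul_comm]

lemma negE_zero {n : ℕ} (x : Fin n → ℚ) : negE x 0 = 0 := by simp [negE]

lemma negE_zero' {n : ℕ} (x : Fin n → ℚ) : negE 0 x = 0 := by simp [negE]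

/-- E8 is unimodular, in the form needed. -/
lemma E8_half (y : Fin 8 → ℚ) (hy : ∀ z ∈ E8Set, ∃ n : ℤ, negE y z = 2 * (n : ℚ)) :
    (1 / 2 : ℚ) • y ∈ E8Set := by
  have hp : ∀ (i : Fin 8) (s : ℤ), i ≠ 0 → s * s = 1 →
      ∃ n : ℤ, y 0 + s * y i = 2 * (n : ℚ) := by
    intro i s hi hs
    have hz : (Pi.single 0 1 + Pi.single i (s : ℚ) : Fin 8 → ℚ) ∈ E8Set := by
      rw [E8_iff]
      refine ⟨⟨0, Pi.single 0 1 + Pi.single i s, fun j => ?_⟩, ?_⟩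
      · simp [Pi.single_apply]
      · have : s = 1 ∨ s = -1 := by
          exact mul_self_eq_one_iff.1 hs
        simp [Finset.sum_add_distrib]
        rcases this with rfl | rfl
        · exact ⟨1, by norm_num⟩
        · exact ⟨0, by norm_num⟩
    obtain ⟨n, hn⟩ := hy _ hz
    refine ⟨-n, ?_⟩
    simp [negE, mul_add, Finset.sum_add_distrib, Pi.single_apply] at hn
    push_cast
    linarith
  have hh : (halfVec 8) ∈ E8Set := by
    rw [E8_iff]
    refine ⟨⟨1, 0, fun j => by simp [halfVec]⟩, 2, by simp [halfVec]; norm_num⟩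
  obtain ⟨m, hm⟩ := hy _ hh
  simp only [negE, halfVec, ← Finset.sum_mul] at hm
  obtain ⟨a, ha⟩ := hp 1 1 (by decide) (by norm_num)
  obtain ⟨b, hb⟩ := hp 1 (-1) (by decide) (by norm_num)
  push_cast at ha hb
  have h0 : y 0 = ((a + b : ℤ) : ℚ) := by push_cast; linarith
  have hi : ∀ i, ∃ n : ℤ, y i = y 0 + 2 * n := by
    intro i
    by_cases h : i = 0
    · exact ⟨0, by simp [h]⟩
    · obtain ⟨b', hb'⟩ := hp i (-1) h (by norm_num)
      exact ⟨-b', by push_cast at *; linarith⟩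
  choose n hn using hi
  rw [E8_iff]
  refine ⟨⟨a + b, n, fun i => ?_⟩, -m, ?_⟩
  · simp only [Pi.smul_apply, smul_eq_mul]; rw [hn i, h0]; ring
  · simp only [Pi.smul_apply, smul_eq_mul, ← Finset.mul_sum]; push_cast; linarith

/-- Ambient space. -/
abbrev AAmb (k : ℕ) := (Fin 4 → ℚ) × (Fin k → Fin 8 → ℚ) × (Fin 2 → ℚ)

def AForm (k : ℕ) (x y : AAmb k) : ℚ :=
  UForm x.1 y.1 + ∑ j, negE (x.2.1 j) (y.2.1 j) + negE x.2.2 y.2.2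

lemma AForm_comm (k : ℕ) (x y : AAmb k) : AForm k x y = AForm k y x := by
  rw [AForm, AForm, negE_comm x.2.2]
  congr 1
  congr 1
  · simp only [UForm]; ring
  · exact Finset.sum_congr rfl fun j _ => negE_comm _ _

lemma AForm_add_left (k : ℕ) (x y z : AAmb k) :
    AForm k (x + y) z = AForm k x z + AForm k y z := by
  simp only [AForm, UForm, Prod.fst_add, Prod.snd_add, Pi.add_apply, negE_add_left,
    Finset.sum_add_distrib]
  ring

lemma AForm_smul_left (k : ℕ) (c : ℚ) (x z : AAmb k) :
    AForm k (c • x) z = c * AForm k x z := by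
  simp only [AForm, UForm, Prod.smul_fst, Prod.smul_snd, Pi.smul_apply, negE_smul_left,
    ← Finset.mul_sum, smul_eq_mul]
  ring

def AB (k : ℕ) : AAmb k →ₗ[ℚ] AAmb k →ₗ[ℚ] ℚ :=
  LinearMap.mk₂ ℚ (AForm k) (AForm_add_left k) (AForm_smul_left k)
    (fun x y z => by rw [AForm_comm, AForm_add_left, AForm_comm k y, AForm_comm k z])
    (fun c x y => by rw [AForm_comm, AForm_smul_left, AForm_comm k y]; rfl)

lemma AB_apply (k : ℕ) (x y : AAmb k) : AB k x y = AForm k x y := rfl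

/-- Mixed lattices: blocks in `S` are `E₈`, the others are joined to `D`. -/
def LS (k : ℕ) (S : Finset (Fin k)) : Set (AAmb k) :=
  {x | IntVec x.1 ∧ IntVec x.2.2 ∧ (∀ j ∈ S, x.2.1 j ∈ E8Set) ∧ (∀ j ∉ S, IntVec (x.2.1 j)) ∧
    ∃ a : ℤ, (∑ j, if j ∈ S then 0 else ∑ i, x.2.1 j i) + ∑ i, x.2.2 i = 2 * (a : ℚ)}

lemma IntVec.add {n : ℕ} {x y : Fin n → ℚ} (hx : IntVec x) (hy : IntVec y) : IntVec (x + y) := by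
  intro i
  obtain ⟨a, ha⟩ := hx i
  obtain ⟨b, hb⟩ := hy i
  exact ⟨a + b, by simp [ha, hb]⟩

lemma IntVec.neg {n : ℕ} {x : Fin n → ℚ} (hx : IntVec x) : IntVec (-x) := by
  intro i
  obtain ⟨a, ha⟩ := hx i
  exact ⟨-a, by simp [ha]⟩

lemma IntVec.zero {n : ℕ} : IntVec (0 : Fin n → ℚ) := fun _ => ⟨0, by simp⟩

/-- The lattice `U² ⊕ E₈^k ⊕ D₂`. -/
def LA (k : ℕ) : AddSubgroup (AAmb k) where
  carrier := {x | IntVec x.1 ∧ (∀ j, x.2.1 j ∈ E8Set) ∧ IntVec x.2.2 ∧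
    ∃ a : ℤ, x.2.2 0 + x.2.2 1 = 2 * (a : ℚ)}
  zero_mem' := ⟨IntVec.zero, fun _ => E8_zero, IntVec.zero, 0, by simp⟩
  add_mem' := by
    rintro x y ⟨h1, h2, h3, a, h4⟩ ⟨h1', h2', h3', a', h4'⟩
    refine ⟨h1.add h1', fun j => E8_add _ _ (h2 j) (h2' j), h3.add h3', a + a', ?_⟩
    simp only [Prod.snd_add, Pi.add_apply]; push_cast; linarith
  neg_mem' := by
    rintro x ⟨h1, h2, h3, a, h4⟩
    refine ⟨h1.neg, fun j => E8_neg _ (h2 j), h3.neg, -a, ?_⟩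
    simp only [Prod.snd_neg, Pi.neg_apply]; push_cast; linarith

lemma mem_LA (k : ℕ) (x : AAmb k) : x ∈ LA k ↔ IntVec x.1 ∧ (∀ j, x.2.1 j ∈ E8Set) ∧
    IntVec x.2.2 ∧ ∃ a : ℤ, x.2.2 0 + x.2.2 1 = 2 * (a : ℚ) := Iff.rfl

lemma mem_LA_iff_LS (k : ℕ) (x : AAmb k) : x ∈ LA k ↔ x ∈ LS k Finset.univ := by
  simp only [mem_LA, LS, Finset.mem_univ, if_true, Set.mem_ofPred_eq, Fin.sum_univ_two,
    Finset.sum_const_zero, zero_add, not_true_eq_false, false_imp_iff, imp_true_iff, true_and,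
    true_imp_iff]
  tauto

lemma LA_int (k : ℕ) : ∀ x ∈ LA k, ∀ y ∈ LA k, ∃ n : ℤ, AB k x y = n := by
  rintro x ⟨h1, h2, h3, -⟩ y ⟨h1', h2', h3', -⟩
  choose a ha using h1
  choose b hb using h1'
  choose c hc using h3
  choose d hd using h3'
  choose m hm using fun j => E8_pair _ _ (h2 j) (h2' j)
  refine ⟨a 0 * b 1 + a 1 * b 0 + a 2 * b 3 + a 3 * b 2 + ∑ j, m j - (c 0 * d 0 + c 1 * d 1), ?_⟩
  rw [AB_apply, AForm]
  simp only [hm]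
  simp only [UForm, negE, ha, hb, hc, hd, Fin.sum_univ_two]
  push_cast; ring

lemma LA_even (k : ℕ) : ∀ x ∈ LA k, ∃ n : ℤ, AB k x x = 2 * (n : ℚ) := by
  rintro x ⟨h1, h2, h3, t, ht⟩
  choose a ha using h1
  choose c hc using h3
  choose m hm using fun j => E8_even _ (h2 j)
  refine ⟨a 0 * a 1 + a 2 * a 3 + ∑ j, m j - (2 * t * t - c 0 * (2 * t - c 0)), ?_⟩
  rw [AB_apply, AForm]
  rw [hc, hc] at ht
  have : (c 1 : ℚ) = 2 * t - c 0 := by linarith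
  simp only [hm]
  simp only [UForm, negE, ha, hc, Fin.sum_univ_two, this, ← Finset.mul_sum]
  push_cast; ring

def aVec (k : ℕ) : AAmb k := (0, 0, ![1, 1])
def bVec (k : ℕ) : AAmb k := (0, 0, ![1, -1])

lemma AB_a (k : ℕ) (x : AAmb k) : AB k (aVec k) x = -(x.2.2 0 + x.2.2 1) := by
  simp [AB_apply, AForm, aVec, UForm, negE]

lemma AB_b (k : ℕ) (x : AAmb k) : AB k (bVec k) x = -(x.2.2 0 - x.2.2 1) := by
  simp [AB_apply, AForm, bVec, UForm, negE]; ring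

lemma aVec_mem (k : ℕ) : aVec k ∈ LA k := by
  refine ⟨IntVec.zero, fun _ => E8_zero, fun i => ⟨1, ?_⟩, 1, ?_⟩
  · fin_cases i <;> simp [aVec]
  · simp [aVec]; norm_num

lemma bVec_mem (k : ℕ) : bVec k ∈ LA k := by
  refine ⟨IntVec.zero, fun _ => E8_zero, fun i => ⟨![1, -1] i, ?_⟩, 0, ?_⟩
  · fin_cases i <;> simp [bVec]
  · simp [bVec]

lemma aVec_div (k : ℕ) : ∀ x ∈ LA k, ∃ n : ℤ, AB k (aVec k) x = 2 * (n : ℚ) := by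
  rintro x ⟨-, -, -, t, ht⟩
  exact ⟨-t, by rw [AB_a, ht]; push_cast; ring⟩

lemma bVec_div (k : ℕ) : ∀ x ∈ LA k, ∃ n : ℤ, AB k (bVec k) x = 2 * (n : ℚ) := by
  rintro x ⟨-, -, h3, t, ht⟩
  obtain ⟨c, hc⟩ := h3 1
  exact ⟨c - t, by rw [AB_b]; push_cast; rw [← hc]; linarith⟩

/-- Vectors of even divisibility. -/
lemma LA_div (k : ℕ) (x : AAmb k) (hx : x ∈ LA k)
    (hd : ∀ y ∈ LA k, ∃ n : ℤ, AB k x y = 2 * (n : ℚ)) :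
    ∃ l ∈ LA k, l.2.2 = 0 ∧ ∃ p q : ℤ,
      x = (p : ℚ) • aVec k + (q : ℚ) • bVec k + (2 : ℚ) • l := by
  have hU : IntVec ((1 / 2 : ℚ) • x.1) := by
    have key : ∀ i : Fin 4, ∃ n : ℤ, AB k x (Pi.single i 1, 0, 0) = 2 * (n : ℚ) := by
      intro i
      refine hd _ ⟨fun j => ⟨(Pi.single i 1 : Fin 4 → ℤ) j, ?_⟩, fun _ => E8_zero, IntVec.zero,
        0, by simp⟩
      simp [Pi.single_apply]
    choose n hn using key
    simp only [AB_apply, AForm, UForm, negE_zero, Finset.sum_const_zero, Pi.zero_apply] at hn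
    intro i
    fin_cases i
    · exact ⟨n 1, by have := hn 1; simp at this ⊢; linarith⟩
    · exact ⟨n 0, by have := hn 0; simp at this ⊢; linarith⟩
    · exact ⟨n 3, by have := hn 3; simp at this ⊢; linarith⟩
    · exact ⟨n 2, by have := hn 2; simp at this ⊢; linarith⟩
  have hE : ∀ j, (1 / 2 : ℚ) • x.2.1 j ∈ E8Set := by
    intro j
    refine E8_half _ fun z hz => ?_
    have hmem : ((0, Pi.single j z, 0) : AAmb k) ∈ LA k := by
      refine ⟨IntVec.zero, fun i => ?_, IntVec.zero, 0, by simp⟩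
      by_cases h : i = j
      · subst h; simpa using hz
      · simpa [h] using E8_zero
    obtain ⟨n, hn⟩ := hd _ hmem
    refine ⟨n, ?_⟩
    rw [← hn, AB_apply, AForm]
    rw [Finset.sum_eq_single j]
    · simp [UForm, negE_zero]
    · intro i _ hij; simp [hij, negE_zero]
    · simp
  obtain ⟨-, -, h3, t, ht⟩ := hx
  obtain ⟨c, hc⟩ := h3 1
  refine ⟨((1 / 2 : ℚ) • x.1, fun j => (1 / 2 : ℚ) • x.2.1 j, 0),
    ⟨hU, hE, IntVec.zero, 0, by simp⟩, rfl, t, t - c, ?_⟩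
  refine Prod.ext ?_ (Prod.ext ?_ ?_)
  · simp [aVec, bVec]
  · funext j i; simp [aVec, bVec]
  · funext i
    fin_cases i
    · simp [aVec, bVec]; rw [← hc]; linarith
    · simp [aVec, bVec, hc]

/-! ### Splitting off one `E₈` block -/

def stepFun (k : ℕ) (j : Fin k) (x : AAmb k) : AAmb k :=
  (![2 * (x.1 0 + x.1 1 - x.2.1 j 7 - x.2.2 0),
     2 * (x.1 0 + x.1 1 - x.2.1 j 7 - x.2.2 0) + (∑ i, x.2.1 j i) / 2, x.1 2, x.1 3],
   Function.update x.2.1 j (fun i => if i = 7 then x.1 0 - x.2.2 0 else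
     x.2.1 j i + (x.1 0 + x.1 1 - x.2.1 j 7 - x.2.2 0)),
   ![x.2.2 0 - x.1 1, x.2.2 1])

def stepInv (k : ℕ) (j : Fin k) (x : AAmb k) : AAmb k :=
  (![x.2.1 j 7 + x.2.2 0 + (2 * x.1 0 + 2 * x.1 1 - ∑ i, x.2.1 j i),
     2 * x.1 0 + 2 * x.1 1 - ∑ i, x.2.1 j i, x.1 2, x.1 3],
   Function.update x.2.1 j (fun i => if i = 7 then
     x.2.1 j 7 + (2 * x.1 0 + 2 * x.1 1 - ∑ i, x.2.1 j i) - x.1 0 / 2 else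
     x.2.1 j i - x.1 0 / 2),
   ![x.2.2 0 + (2 * x.1 0 + 2 * x.1 1 - ∑ i, x.2.1 j i), x.2.2 1])

lemma if7 (i : Fin 8) (hi : i ≠ 7) (a b : ℚ) : (if i = 7 then a else b) = b := if_neg hi

lemma sum8_if (a : ℚ) (f : Fin 8 → ℚ) : ∑ i : Fin 8, (if i = 7 then a else f i) =
    f 0 + f 1 + f 2 + f 3 + f 4 + f 5 + f 6 + a := by
  rw [Fin.sum_univ_eight]
  simp [show (0 : Fin 8) ≠ 7 by decide, show (1 : Fin 8) ≠ 7 by decide,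
    show (2 : Fin 8) ≠ 7 by decide, show (3 : Fin 8) ≠ 7 by decide, show (4 : Fin 8) ≠ 7 by decide,
    show (5 : Fin 8) ≠ 7 by decide, show (6 : Fin 8) ≠ 7 by decide]

lemma step_left (k : ℕ) (j : Fin k) (x : AAmb k) : stepInv k j (stepFun k j x) = x := by
  refine Prod.ext ?_ (Prod.ext ?_ ?_)
  · funext i
    fin_cases i <;>
      simp [stepInv, stepFun, sum8_if, Fin.sum_univ_eight] <;> ring
  · simp only [stepInv, stepFun, Function.update_idem]
    rw [Function.update_eq_iff]
    refine ⟨?_, fun _ _ => rfl⟩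
    funext i
    by_cases hi : i = 7
    · subst hi; simp [sum8_if, Fin.sum_univ_eight]; ring
    · simp [hi]
  · funext i
    fin_cases i <;>
      simp [stepInv, stepFun, sum8_if, Fin.sum_univ_eight]
    ring

lemma step_right (k : ℕ) (j : Fin k) (x : AAmb k) : stepFun k j (stepInv k j x) = x := by
  refine Prod.ext ?_ (Prod.ext ?_ ?_)
  · funext i
    fin_cases i <;>
      simp [stepInv, stepFun, sum8_if, Fin.sum_univ_eight] <;> ring
  · simp only [stepInv, stepFun, Function.update_idem]
    rw [Function.update_eq_iff]
    refine ⟨?_, fun _ _ => rfl⟩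
    funext i
    by_cases hi : i = 7
    · subst hi; simp [Fin.sum_univ_eight]
    · simp [hi]; ring
  · funext i
    fin_cases i <;>
      simp [stepInv, stepFun, sum8_if, Fin.sum_univ_eight]

def stepEquiv (k : ℕ) (j : Fin k) : AAmb k ≃ₗ[ℚ] AAmb k where
  toFun := stepFun k j
  invFun := stepInv k j
  left_inv := step_left k j
  right_inv := step_right k j
  map_add' := by
    intro x y
    refine Prod.ext ?_ (Prod.ext ?_ ?_)
    · funext i
      fin_cases i <;>
        simp [stepFun, Finset.sum_add_distrib] <;> ring
    · simp only [stepFun]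
      rw [Function.update_eq_iff]
      refine ⟨?_, fun l hl => by simp [hl]⟩
      funext i
      by_cases hi : i = 7
      · subst hi; simp; ring
      · simp [hi]; ring
    · funext i
      fin_cases i <;> simp [stepFun]
      ring
  map_smul' := by
    intro c x
    refine Prod.ext ?_ (Prod.ext ?_ ?_)
    · funext i
      fin_cases i <;>
        simp [stepFun, ← Finset.mul_sum] <;> ring
    · simp only [stepFun]
      rw [Function.update_eq_iff]
      refine ⟨?_, fun l hl => by simp [hl]⟩
      funext i
      by_cases hi : i = 7
      · subst hi; simp; ring
      · simp [hi]; ring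
    · funext i
      fin_cases i <;> simp [stepFun]
      ring

lemma step_form (k : ℕ) (j : Fin k) (x y : AAmb k) :
    AForm k (stepFun k j x) (stepFun k j y) = AForm k x y := by
  have h1 : ∀ z : AAmb k, ∀ l ∈ Finset.univ.erase j, (stepFun k j z).2.1 l = z.2.1 l := by
    intro z l hl
    simp [stepFun, Finset.ne_of_mem_erase hl]
  rw [AForm, AForm, ← Finset.add_sum_erase _ _ (Finset.mem_univ j),
    ← Finset.add_sum_erase _ _ (Finset.mem_univ j),
    Finset.sum_congr rfl (fun l hl => by rw [h1 x l hl, h1 y l hl])]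
  have h2 : negE ((stepFun k j x).2.1 j) ((stepFun k j y).2.1 j) =
     -(∑ i : Fin 8, if i = 7 then (x.1 0 - x.2.2 0) * (y.1 0 - y.2.2 0) else
     (x.2.1 j i + (x.1 0 + x.1 1 - x.2.1 j 7 - x.2.2 0)) *
     (y.2.1 j i + (y.1 0 + y.1 1 - y.2.1 j 7 - y.2.2 0))) := by
    simp only [negE, stepFun, Function.update_self]
    refine congrArg Neg.neg (Finset.sum_congr rfl fun i _ => ?_)
    by_cases hi : i = 7
    · simp [hi]
    · simp [hi]
  rw [h2, sum8_if]
  simp [UForm, negE, stepFun, Fin.sum_univ_eight]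
  ring

lemma step_mem (k : ℕ) (S : Finset (Fin k)) (j : Fin k) (hj : j ∉ S) (x : AAmb k)
    (hx : x ∈ LS k (insert j S)) : stepFun k j x ∈ LS k S := by
  obtain ⟨h1, h2, h3, h4, t, ht⟩ := hx
  choose u hu using h1
  choose r hr using h2
  obtain ⟨⟨h, n, hn⟩, a, ha⟩ := (E8_iff _).1 (h3 j (Finset.mem_insert_self j S))
  refine ⟨?_, ?_, ?_, ?_, ?_⟩
  · intro i
    fin_cases i
    · exact ⟨2 * (u 0 + u 1 - n 7 - r 0) - h, by simp [stepFun, hu, hr, hn]; ring⟩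
    · exact ⟨2 * (u 0 + u 1 - n 7 - r 0) - h + a, by
        simp only [stepFun, ha]; simp [hu, hr, hn]; ring⟩
    · exact ⟨u 2, by simp [stepFun, hu]⟩
    · exact ⟨u 3, by simp [stepFun, hu]⟩
  · intro i
    fin_cases i
    · exact ⟨r 0 - u 1, by simp [stepFun, hu, hr]⟩
    · exact ⟨r 1, by simp [stepFun, hr]⟩
  · intro l hl
    have : l ≠ j := by rintro rfl; exact hj hl
    simpa [stepFun, this] using h3 l (Finset.mem_insert_of_mem hl)
  · intro l hl
    by_cases hlj : l = j
    · subst hlj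
      intro i
      by_cases hi : i = 7
      · exact ⟨u 0 - r 0, by simp [stepFun, hi, hu, hr]⟩
      · exact ⟨n i + (u 0 + u 1 - n 7 - r 0), by simp [stepFun, hi, hu, hr, hn]; ring⟩
    · simpa [stepFun, hlj] using h4 l (by simp [hlj, hl])
  · rw [← Finset.add_sum_erase _ _ (Finset.mem_univ j)] at ht ⊢
    have hc : ∀ l ∈ Finset.univ.erase j, (if l ∈ S then (0 : ℚ) else ∑ i, (stepFun k j x).2.1 l i) =
        if l ∈ insert j S then 0 else ∑ i, x.2.1 l i := by
      intro l hl
      have := Finset.ne_of_mem_erase hl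
      simp [stepFun, this]
    rw [Finset.sum_congr rfl hc]
    simp only [Finset.mem_insert_self, if_true, zero_add] at ht
    rw [if_neg hj]
    have h8 : ∑ i, (stepFun k j x).2.1 j i =
        2 * a + 8 * (u 0 + u 1 - n 7 - h / 2 - r 0) - u 1 := by
      rw [← ha]
      simp only [stepFun, Function.update_self]
      rw [sum8_if, Fin.sum_univ_eight]
      simp only [hu, hr, hn]
      ring
    rw [h8]
    simp only [Fin.sum_univ_two] at ht ⊢
    refine ⟨t + a + 4 * (u 0 + u 1 - n 7 - r 0) - 2 * h - u 1, ?_⟩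
    have e0 : (stepFun k j x).2.2 0 = x.2.2 0 - u 1 := by simp [stepFun, hu]
    have e1 : (stepFun k j x).2.2 1 = x.2.2 1 := by simp [stepFun]
    rw [e0, e1]
    push_cast
    linear_combination ht

lemma stepInv_mem (k : ℕ) (S : Finset (Fin k)) (j : Fin k) (hj : j ∉ S) (x : AAmb k)
    (hx : x ∈ LS k S) : stepInv k j x ∈ LS k (insert j S) := by
  obtain ⟨h1, h2, h3, h4, t, ht⟩ := hx
  choose u hu using h1
  choose r hr using h2
  choose n hn using h4 j hj
  have hsum : ∑ i, x.2.1 j i = ((∑ i, n i : ℤ) : ℚ) := by push_cast; simp [hn]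
  set σ := ∑ i, n i with hσ
  refine ⟨?_, ?_, ?_, ?_, ?_⟩
  · intro i
    fin_cases i
    · exact ⟨n 7 + r 0 + (2 * u 0 + 2 * u 1 - σ), by simp [stepInv, hu, hr, hsum, hn 7]⟩
    · exact ⟨2 * u 0 + 2 * u 1 - σ, by simp [stepInv, hu, hsum]⟩
    · exact ⟨u 2, by simp [stepInv, hu]⟩
    · exact ⟨u 3, by simp [stepInv, hu]⟩
  · intro i
    fin_cases i
    · exact ⟨r 0 + (2 * u 0 + 2 * u 1 - σ), by simp [stepInv, hu, hr, hsum]⟩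
    · exact ⟨r 1, by simp [stepInv, hr]⟩
  · intro l hl
    by_cases hlj : l = j
    · subst hlj
      rw [E8_iff]
      refine ⟨⟨-u 0, fun i => if i = 7 then n 7 + (2 * u 0 + 2 * u 1 - σ) else n i, ?_⟩,
        u 1 - u 0, ?_⟩
      · intro i
        by_cases hi : i = 7
        · simp [stepInv, hi, hu, hsum, hn 7]; ring
        · simp [stepInv, hi, hu, hn]; ring
      · simp only [stepInv, Function.update_self]
        rw [sum8_if, Fin.sum_univ_eight]
        simp only [hu, hn]
        push_cast
        ring
    · simpa [stepInv, hlj] using h3 l (by simpa [hlj] using hl)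
  · intro l hl
    have hl' : l ≠ j ∧ l ∉ S := by simpa using hl
    simpa [stepInv, hl'.1] using h4 l hl'.2
  · rw [← Finset.add_sum_erase _ _ (Finset.mem_univ j)] at ht ⊢
    have hc : ∀ l ∈ Finset.univ.erase j, (if l ∈ insert j S then (0 : ℚ) else
        ∑ i, (stepInv k j x).2.1 l i) = if l ∈ S then 0 else ∑ i, x.2.1 l i := by
      intro l hl
      have := Finset.ne_of_mem_erase hl
      simp [stepInv, this]
    rw [Finset.sum_congr rfl hc]
    simp only [Finset.mem_insert_self, if_true, zero_add]
    rw [if_neg hj, hsum] at ht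
    simp only [Fin.sum_univ_two] at ht ⊢
    refine ⟨t + u 0 + u 1 - σ, ?_⟩
    have e0 : (stepInv k j x).2.2 0 = x.2.2 0 + (2 * u 0 + 2 * u 1 - σ) := by
      simp [stepInv, hu, hsum]
    have e1 : (stepInv k j x).2.2 1 = x.2.2 1 := by simp [stepInv]
    rw [e0, e1]
    push_cast
    linear_combination ht

lemma chain (k : ℕ) (S : Finset (Fin k)) : ∃ Φ : AAmb k ≃ₗ[ℚ] AAmb k,
    (∀ x y, AForm k (Φ x) (Φ y) = AForm k x y) ∧ ∀ x, Φ x ∈ LS k ∅ ↔ x ∈ LS k S := by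
  induction S using Finset.induction_on with
  | empty => exact ⟨LinearEquiv.refl ℚ _, fun _ _ => rfl, fun _ => Iff.rfl⟩
  | insert j S hj ih =>
    obtain ⟨Φ, h1, h2⟩ := ih
    refine ⟨(stepEquiv k j).trans Φ, fun x y => ?_, fun x => ?_⟩
    · rw [LinearEquiv.trans_apply, LinearEquiv.trans_apply, h1]
      exact step_form k j x y
    · rw [LinearEquiv.trans_apply, h2]
      refine ⟨fun h => ?_, fun h => step_mem k S j hj x h⟩
      have := stepInv_mem k S j hj _ h
      rwa [show stepInv k j (stepEquiv k j x) = x from step_left k j x] at this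

/-! ### Reindexing -/

def sig (k : ℕ) : Fin (8 * k + 4 + 2) ≃ Fin 4 ⊕ ((Fin k × Fin 8) ⊕ Fin 2) :=
  (finCongr (show 8 * k + 4 + 2 = 4 + (k * 8 + 2) by ring)).trans
    (finSumFinEquiv.symm.trans (Equiv.sumCongr (Equiv.refl _)
      (finSumFinEquiv.symm.trans (Equiv.sumCongr finProdFinEquiv.symm (Equiv.refl _)))))

lemma sig_inl (k : ℕ) (i : Fin 4) : (((sig k).symm (Sum.inl i) : Fin (8 * k + 4 + 2)) : ℕ) = i := by
  simp [sig]

lemma sig_inr (k : ℕ) (t : (Fin k × Fin 8) ⊕ Fin 2) :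
    4 ≤ (((sig k).symm (Sum.inr t) : Fin (8 * k + 4 + 2)) : ℕ) := by
  simp [sig]

lemma sig_sum (k : ℕ) (f : Fin (8 * k + 4 + 2) → ℚ) :
    (∑ i : Fin (8 * k + 4 + 2), if 4 ≤ (i : ℕ) then f i else 0) =
      ∑ j, ∑ i, f ((sig k).symm (Sum.inr (Sum.inl (j, i)))) +
      ∑ i, f ((sig k).symm (Sum.inr (Sum.inr i))) := by
  rw [← (sig k).symm.sum_comp, Fintype.sum_sum_type, Fintype.sum_sum_type]
  have h0 : ∀ i : Fin 4, ¬ (4 ≤ (((sig k).symm (Sum.inl i) : Fin (8 * k + 4 + 2)) : ℕ)) := by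
    intro i; rw [sig_inl]; omega
  simp only [h0, if_false, sig_inr, if_true, Finset.sum_const_zero, zero_add,
    Fintype.sum_prod_type]

def reidx (k : ℕ) : AAmb k ≃ₗ[ℚ] (Fin (8 * k + 4 + 2) → ℚ) where
  toFun x i := Sum.elim x.1 (Sum.elim (fun p => x.2.1 p.1 p.2) x.2.2) (sig k i)
  invFun z := (fun i => z ((sig k).symm (Sum.inl i)),
    fun j i => z ((sig k).symm (Sum.inr (Sum.inl (j, i)))),
    fun i => z ((sig k).symm (Sum.inr (Sum.inr i))))
  left_inv x := by simp
  right_inv z := by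
    funext i
    obtain ⟨t, rfl⟩ := (sig k).symm.surjective i
    rcases t with t | t | t <;> simp
  map_add' x y := by
    funext i
    obtain ⟨t, rfl⟩ := (sig k).symm.surjective i
    rcases t with t | t | t <;> simp
  map_smul' c x := by
    funext i
    obtain ⟨t, rfl⟩ := (sig k).symm.surjective i
    rcases t with t | t | t <;> simp

lemma reidx_inl (k : ℕ) (x : AAmb k) (i : Fin 4) :
    reidx k x ((sig k).symm (Sum.inl i)) = x.1 i := by simp [reidx]

lemma reidx_inr1 (k : ℕ) (x : AAmb k) (j : Fin k) (i : Fin 8) :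
    reidx k x ((sig k).symm (Sum.inr (Sum.inl (j, i)))) = x.2.1 j i := by simp [reidx]

lemma reidx_inr2 (k : ℕ) (x : AAmb k) (i : Fin 2) :
    reidx k x ((sig k).symm (Sum.inr (Sum.inr i))) = x.2.2 i := by simp [reidx]

lemma reidx_form (k : ℕ) (x y : AAmb k) :
    LamForm (8 * k + 4) (reidx k x) (reidx k y) = AForm k x y := by
  have h0 : (0 : Fin (8 * k + 4 + 2)) = (sig k).symm (Sum.inl 0) := by
    apply Fin.ext; rw [sig_inl]; rfl
  have h1 : (1 : Fin (8 * k + 4 + 2)) = (sig k).symm (Sum.inl 1) := by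
    apply Fin.ext; rw [sig_inl]; rfl
  have h2 : (2 : Fin (8 * k + 4 + 2)) = (sig k).symm (Sum.inl 2) := by
    apply Fin.ext; rw [sig_inl]; simp
  have h3 : (3 : Fin (8 * k + 4 + 2)) = (sig k).symm (Sum.inl 3) := by
    apply Fin.ext; rw [sig_inl]; simp
  rw [LamForm, sig_sum k (fun i => reidx k x i * reidx k y i), h0, h1, h2, h3]
  simp only [reidx_inl, reidx_inr1, reidx_inr2, AForm, UForm, negE, Finset.sum_neg_distrib]
  ring

lemma reidx_mem (k : ℕ) (x : AAmb k) : reidx k x ∈ LamSet (8 * k + 4) ↔ x ∈ LS k ∅ := by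
  simp only [LamSet, LS, Set.mem_ofPred_eq, sig_sum k (fun i => reidx k x i), reidx_inr1,
    reidx_inr2, Finset.notMem_empty, if_false]
  have : IntVec (reidx k x) ↔ IntVec x.1 ∧ IntVec x.2.2 ∧ ∀ j, IntVec (x.2.1 j) := by
    constructor
    · intro h
      refine ⟨fun i => ?_, fun i => ?_, fun j i => ?_⟩
      · rw [← reidx_inl]; exact h _
      · rw [← reidx_inr2]; exact h _
      · rw [← reidx_inr1]; exact h _
    · rintro ⟨h1, h2, h3⟩ i
      obtain ⟨t, rfl⟩ := (sig k).symm.surjective i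
      rcases t with t | ⟨j, t⟩ | t
      · rw [reidx_inl]; exact h1 _
      · rw [reidx_inr1]; exact h3 _ _
      · rw [reidx_inr2]; exact h2 _
  rw [this]
  simp only [not_false_eq_true, false_imp_iff, imp_true_iff, true_imp_iff, true_and]
  tauto

lemma exists_model (k : ℕ) : ∃ Ψ : AAmb k ≃ₗ[ℚ] (Fin (8 * k + 4 + 2) → ℚ),
    (∀ x y, LamForm (8 * k + 4) (Ψ x) (Ψ y) = AB k x y) ∧
    ∀ x, Ψ x ∈ LamSet (8 * k + 4) ↔ x ∈ LA k := by
  obtain ⟨Φ, h1, h2⟩ := chain k Finset.univ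
  refine ⟨Φ.trans (reidx k), fun x y => ?_, fun x => ?_⟩
  · rw [LinearEquiv.trans_apply, LinearEquiv.trans_apply, reidx_form, h1]; rfl
  · rw [LinearEquiv.trans_apply, reidx_mem, h2, mem_LA_iff_LS]

/-! ### Transitivity on the model -/

lemma AB_frame (k : ℕ) (x : AAmb k) (u : Fin 4 → ℚ) : AB k x (u, 0, 0) = UForm x.1 u := by
  simp [AB_apply, AForm, negE_zero]

lemma single_mem (k : ℕ) (i : Fin 4) : ((Pi.single i 1, 0, 0) : AAmb k) ∈ LA k := by
  refine ⟨fun j => ⟨(Pi.single i 1 : Fin 4 → ℤ) j, ?_⟩, fun _ => E8_zero, IntVec.zero, 0, by simp⟩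
  simp [Pi.single_apply]

/-- The Eichler criterion in the model. -/
lemma model_eichler (k : ℕ) (d a w : AAmb k) (ha : a ∈ LA k) (ha1 : a.1 = 0) (hd1 : d.1 = 0)
    (da : AB k d a = 0) (dw : AB k d w = 0) (haa : AB k a a = -2) (hww : AB k w w = -2)
    (hadiv : ∀ x ∈ LA k, ∃ n : ℤ, AB k a x = 2 * (n : ℚ))
    (hwa : ∃ l ∈ LA k, w = a + (2 : ℚ) • l) :
    ∃ g : AAmb k ≃ₗ[ℚ] AAmb k, IsIso (AB k) (LA k) d g ∧ g w = a := by
  refine eichler (AB k) (AForm_comm k) (LA k) (LA_int k) (LA_even k) d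
    (Pi.single 0 1, 0, 0) (Pi.single 1 1, 0, 0) (Pi.single 2 1, 0, 0) (Pi.single 3 1, 0, 0) a w
    (single_mem k 0) (single_mem k 1) (single_mem k 2) (single_mem k 3) ha
    ?_ ?_ ?_ ?_ ?_ ?_ ?_ ?_ ?_ ?_ ?_ ?_ ?_ ?_ ?_ ?_ da dw haa hww hadiv hwa
  all_goals rw [AB_frame]; simp [UForm, ha1, hd1]

lemma core (k : ℕ) (a b w x : AAmb k) (ha : a ∈ LA k) (hb : b ∈ LA k) (ha1 : a.1 = 0)
    (hb1 : b.1 = 0) (haa : AB k a a = -2) (hbb : AB k b b = -2) (hab : AB k a b = 0)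
    (hadiv : ∀ x ∈ LA k, ∃ n : ℤ, AB k a x = 2 * (n : ℚ))
    (hbdiv : ∀ x ∈ LA k, ∃ n : ℤ, AB k b x = 2 * (n : ℚ))
    (hrep : ∀ x ∈ LA k, (∀ y ∈ LA k, ∃ n : ℤ, AB k x y = 2 * (n : ℚ)) →
      ∃ l ∈ LA k, AB k a l = 0 ∧ AB k b l = 0 ∧ ∃ p q : ℤ,
        x = (p : ℚ) • a + (q : ℚ) • b + (2 : ℚ) • l)
    (hww : AB k w w = -2) (hwa : ∃ l ∈ LA k, w = a + (2 : ℚ) • l)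
    (hx : x ∈ LA k) (hxx : AB k x x = -2) (hwx : AB k w x = 0)
    (hxdiv : ∀ y ∈ LA k, ∃ n : ℤ, AB k x y = 2 * (n : ℚ)) :
    ∃ g : AAmb k ≃ₗ[ℚ] AAmb k, (∀ x y, AB k (g x) (g y) = AB k x y) ∧
      (∀ x, g x ∈ LA k ↔ x ∈ LA k) ∧ g w = a ∧ g x = b := by
  have hs : ∀ x y, AB k x y = AB k y x := AForm_comm k
  obtain ⟨g, ⟨g1, g2, -⟩, gw⟩ := model_eichler k 0 a w ha ha1 rfl (by simp) (by simp) haa hww hadiv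
    hwa
  have hgx : g x ∈ LA k := (g2 x).2 hx
  have hagx : AB k a (g x) = 0 := by rw [← gw, g1, hwx]
  have hgxx : AB k (g x) (g x) = -2 := by rw [g1, hxx]
  obtain ⟨l, hl, hal, hbl, p, q, hpq⟩ := hrep (g x) hgx (fun y hy => by
    have : g.symm y ∈ LA k := by rw [← g2]; simpa using hy
    obtain ⟨n, hn⟩ := hxdiv _ this
    refine ⟨n, ?_⟩
    rw [← hn, ← g1 x (g.symm y), LinearEquiv.apply_symm_apply])
  have hp : (p : ℚ) = 0 := by
    rw [hpq] at hagx
    simp [haa, hab, hal] at hagx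
    exact_mod_cast hagx
  rw [hp, zero_smul, zero_add] at hpq
  obtain ⟨n, hn⟩ := LA_even k l hl
  have hq : q * q = 1 + 4 * n := by
    rw [hpq] at hgxx
    simp [hbb, hbl, hs l b, hn] at hgxx
    have : (q * q : ℚ) = 1 + 4 * n := by linarith
    exact_mod_cast this
  have hqo : Odd q := by
    have : Odd (q * q) := ⟨2 * n, by rw [hq]; ring⟩
    exact (Int.odd_mul.1 this).1
  obtain ⟨m, rfl⟩ := hqo
  have hxb : ∃ l ∈ LA k, g x = b + (2 : ℚ) • l := by
    refine ⟨(m : ℚ) • b + l, (LA k).add_mem (zsmul_mem_q _ hb m rfl) hl, ?_⟩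
    rw [hpq]; push_cast; module
  obtain ⟨h, ⟨h1, h2, h3⟩, hx'⟩ := model_eichler k a b (g x) hb hb1 ha1 hab hagx hbb hgxx hbdiv hxb
  refine ⟨g.trans h, fun x y => ?_, fun x => ?_, ?_, ?_⟩
  · simp [h1, g1]
  · simp [h2, g2]
  · simp [gw, h3]
  · simpa using hx'

lemma model_main (k : ℕ) (w x : AAmb k) (hw : w ∈ LA k) (hx : x ∈ LA k)
    (hww : AB k w w = -2) (hxx : AB k x x = -2) (hwx : AB k w x = 0)
    (hwdiv : ∀ y ∈ LA k, ∃ n : ℤ, AB k w y = 2 * (n : ℚ))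
    (hxdiv : ∀ y ∈ LA k, ∃ n : ℤ, AB k x y = 2 * (n : ℚ)) :
    ∃ g : AAmb k ≃ₗ[ℚ] AAmb k, (∀ x y, AB k (g x) (g y) = AB k x y) ∧
      (∀ x, g x ∈ LA k ↔ x ∈ LA k) ∧
      ((g w = aVec k ∧ g x = bVec k) ∨ (g w = bVec k ∧ g x = aVec k)) := by
  have hs : ∀ x y, AB k x y = AB k y x := AForm_comm k
  have haa : AB k (aVec k) (aVec k) = -2 := by rw [AB_a]; simp [aVec]; norm_num
  have hbb : AB k (bVec k) (bVec k) = -2 := by rw [AB_b]; simp [bVec]; norm_num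
  have hab : AB k (aVec k) (bVec k) = 0 := by rw [AB_a]; simp [bVec]
  have hba : AB k (bVec k) (aVec k) = 0 := by rw [hs, hab]
  have hrep : ∀ x ∈ LA k, (∀ y ∈ LA k, ∃ n : ℤ, AB k x y = 2 * (n : ℚ)) →
      ∃ l ∈ LA k, AB k (aVec k) l = 0 ∧ AB k (bVec k) l = 0 ∧ ∃ p q : ℤ,
        x = (p : ℚ) • aVec k + (q : ℚ) • bVec k + (2 : ℚ) • l := by
    intro x hx hd
    obtain ⟨l, hl, h0, p, q, h⟩ := LA_div k x hx hd
    exact ⟨l, hl, by rw [AB_a, h0]; simp, by rw [AB_b, h0]; simp, p, q, h⟩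
  obtain ⟨l, hl, hal, hbl, p, q, hpq⟩ := hrep w hw hwdiv
  obtain ⟨n, hn⟩ := LA_even k l hl
  have hn2 : p * p + q * q = 1 + 4 * n := by
    have h := hww
    rw [hpq] at h
    simp [haa, hbb, hab, hba, hal, hbl, hs l, hn] at h
    have : (p * p + q * q : ℚ) = 1 + 4 * n := by linarith
    exact_mod_cast this
  rcases Int.even_or_odd' p with ⟨p', rfl | rfl⟩ <;> rcases Int.even_or_odd' q with ⟨q', rfl | rfl⟩
  · exfalso; ring_nf at hn2; omega
  · obtain ⟨g, h1, h2, h3, h4⟩ := core k (bVec k) (aVec k) w x (bVec_mem k) (aVec_mem k) rfl rfl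
      hbb haa hba (bVec_div k) (aVec_div k) (fun x hx hd => by
        obtain ⟨l, hl, h0, h1, p, q, h⟩ := hrep x hx hd
        exact ⟨l, hl, h1, h0, q, p, by rw [h]; module⟩) hww
      ⟨(p' : ℚ) • aVec k + (q' : ℚ) • bVec k + l, (LA k).add_mem ((LA k).add_mem
        (zsmul_mem_q _ (aVec_mem k) _ rfl) (zsmul_mem_q _ (bVec_mem k) _ rfl)) hl, by
        rw [hpq]; push_cast; module⟩ hx hxx hwx hxdiv
    exact ⟨g, h1, h2, Or.inr ⟨h3, h4⟩⟩
  · obtain ⟨g, h1, h2, h3, h4⟩ := core k (aVec k) (bVec k) w x (aVec_mem k) (bVec_mem k) rfl rfl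
      haa hbb hab (aVec_div k) (bVec_div k) hrep hww
      ⟨(p' : ℚ) • aVec k + (q' : ℚ) • bVec k + l, (LA k).add_mem ((LA k).add_mem
        (zsmul_mem_q _ (aVec_mem k) _ rfl) (zsmul_mem_q _ (bVec_mem k) _ rfl)) hl, by
        rw [hpq]; push_cast; module⟩ hx hxx hwx hxdiv
    exact ⟨g, h1, h2, Or.inl ⟨h3, h4⟩⟩
  · exfalso; ring_nf at hn2; omega

/-- The pairing of a hyperelliptic and a unigonal vector is `2` modulo `4`. -/
lemma model_pair (k : ℕ) (v w : AAmb k) (hv : v ∈ LA k) (hw : w ∈ LA k)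
    (hvv : AB k v v = -4) (hww : AB k w w = -2)
    (hvdiv : ∀ y ∈ LA k, ∃ n : ℤ, AB k v y = 2 * (n : ℚ))
    (hwdiv : ∀ y ∈ LA k, ∃ n : ℤ, AB k w y = 2 * (n : ℚ)) :
    ∃ m : ℤ, Odd m ∧ AB k v w = 2 * (m : ℚ) := by
  have hs : ∀ x y, AB k x y = AB k y x := AForm_comm k
  have haa : AB k (aVec k) (aVec k) = -2 := by rw [AB_a]; simp [aVec]; norm_num
  have hbb : AB k (bVec k) (bVec k) = -2 := by rw [AB_b]; simp [bVec]; norm_num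
  have hab : AB k (aVec k) (bVec k) = 0 := by rw [AB_a]; simp [bVec]
  have hba : AB k (bVec k) (aVec k) = 0 := by rw [hs, hab]
  obtain ⟨l, hl, h0, p, q, hpq⟩ := LA_div k w hw hwdiv
  obtain ⟨l', hl', h0', p', q', hpq'⟩ := LA_div k v hv hvdiv
  have hal : AB k (aVec k) l = 0 := by rw [AB_a, h0]; simp
  have hbl : AB k (bVec k) l = 0 := by rw [AB_b, h0]; simp
  have hal' : AB k (aVec k) l' = 0 := by rw [AB_a, h0']; simp
  have hbl' : AB k (bVec k) l' = 0 := by rw [AB_b, h0']; simp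
  have hla' : AB k l' (aVec k) = 0 := by rw [hs, hal']
  have hlb' : AB k l' (bVec k) = 0 := by rw [hs, hbl']
  have hla : AB k l (aVec k) = 0 := by rw [hs, hal]
  have hlb : AB k l (bVec k) = 0 := by rw [hs, hbl]
  obtain ⟨n, hn⟩ := LA_even k l hl
  obtain ⟨n', hn'⟩ := LA_even k l' hl'
  obtain ⟨t, ht⟩ := LA_int k l' hl' l hl
  have hn2 : p * p + q * q = 1 + 4 * n := by
    rw [hpq] at hww
    simp [haa, hbb, hab, hba, hal, hbl, hla, hlb, hn] at hww
    have : (p * p + q * q : ℚ) = 1 + 4 * n := by linarith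
    exact_mod_cast this
  have hn2' : p' * p' + q' * q' = 2 + 4 * n' := by
    rw [hpq'] at hvv
    simp [haa, hbb, hab, hba, hal', hbl', hla', hlb', hn'] at hvv
    have : (p' * p' + q' * q' : ℚ) = 2 + 4 * n' := by linarith
    exact_mod_cast this
  refine ⟨2 * t - (p * p' + q * q'), ?_, ?_⟩
  · have h1 : Odd (p * p + q * q) := ⟨2 * n, by rw [hn2]; ring⟩
    have h2 : ¬ (Even p' ∧ Even q') := by
      rintro ⟨⟨a, rfl⟩, ⟨b, rfl⟩⟩
      ring_nf at hn2'; omega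
    have h3 : Even (p' * p' + q' * q') := ⟨1 + 2 * n', by rw [hn2']; ring⟩
    simp only [Int.even_add, Int.even_mul, Int.even_sub, ← Int.not_even_iff_odd, even_two,
      or_self, true_or] at h1 h2 h3 ⊢
    tauto
  · rw [hpq, hpq']
    simp [haa, hbb, hab, hba, hal, hbl, hla', hlb', ht]
    ring

lemma final_aux (k : ℕ)
    (v w : Fin (8 * k + 4 + 2) → ℚ)
    (hvL : v ∈ LamSet (8 * k + 4)) (hwL : w ∈ LamSet (8 * k + 4))
    (hv2 : LamForm (8 * k + 4) v v = -4) (hw2 : LamForm (8 * k + 4) w w = -2)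
    (hvdiv : HasDiv (8 * k + 4) v 2) (hwdiv : HasDiv (8 * k + 4) w 2)
    (hindep : ∀ a b : ℚ, a • v + b • w = 0 → a = 0 ∧ b = 0)
    (hnegdef : ∀ a b : ℚ, ¬(a = 0 ∧ b = 0) →
      LamForm (8 * k + 4) (a • v + b • w) (a • v + b • w) < 0) :
    (LamForm (8 * k + 4) v w = 2 ∨ LamForm (8 * k + 4) v w = -2) ∧
    ∃ w', (w' = w ∨ w' = -w) ∧ LamForm (8 * k + 4) v w' = 2 ∧
      LamForm (8 * k + 4) (v + w') (v + w') = -2 ∧ LamForm (8 * k + 4) (v + w') w' = 0 ∧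
      (∃ G : (Fin 2 → ℚ) →ₗ[ℚ] (Fin (8 * k + 4 + 2) → ℚ),
        Function.Injective G ∧
        (∀ x y, LamForm (8 * k + 4) (G x) (G y) = negE x y) ∧
        G '' DSet 2 = {z | ∃ a b : ℤ, z = (a : ℚ) • v + (b : ℚ) • w}) ∧
      (∀ x ∈ LamSet (8 * k + 4), ∃ a b : ℤ, ∃ y, y ∈ LamSet (8 * k + 4) ∧
        LamForm (8 * k + 4) y v = 0 ∧ LamForm (8 * k + 4) y w = 0 ∧
        x = (a : ℚ) • v + (b : ℚ) • w + y) ∧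
      (∃ F : IIAmb k →ₗ[ℚ] (Fin (8 * k + 4 + 2) → ℚ),
        Function.Injective F ∧
        (∀ x y, LamForm (8 * k + 4) (F x) (F y) = IIForm k x y) ∧
        F '' IISet k =
          {x | x ∈ LamSet (8 * k + 4) ∧ LamForm (8 * k + 4) x v = 0 ∧
            LamForm (8 * k + 4) x w = 0}) := by
  obtain ⟨Ψ, hΨ, hΨL⟩ := exists_model k
  have hs : ∀ x y, AB k x y = AB k y x := AForm_comm k
  obtain ⟨v₀, rfl⟩ := Ψ.surjective v
  obtain ⟨w₀, rfl⟩ := Ψ.surjective w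
  have hF : ∀ x y, LamForm (8 * k + 4) x y = AB k (Ψ.symm x) (Ψ.symm y) := by
    intro x y; rw [← hΨ]; simp
  have hM : ∀ x, x ∈ LamSet (8 * k + 4) ↔ Ψ.symm x ∈ LA k := by
    intro x; rw [← hΨL]; simp
  have hdv : ∀ y ∈ LA k, ∃ n : ℤ, AB k v₀ y = 2 * (n : ℚ) := by
    intro y hy
    obtain ⟨n, hn⟩ := hvdiv.1 (Ψ y) ((hΨL y).2 hy)
    exact ⟨n, by rw [← hΨ, hn]; norm_num⟩
  have hdw : ∀ y ∈ LA k, ∃ n : ℤ, AB k w₀ y = 2 * (n : ℚ) := by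
    intro y hy
    obtain ⟨n, hn⟩ := hwdiv.1 (Ψ y) ((hΨL y).2 hy)
    exact ⟨n, by rw [← hΨ, hn]; norm_num⟩
  rw [hΨ] at hv2 hw2
  rw [hΨL] at hvL hwL
  clear hvdiv hwdiv
  obtain ⟨m, hmo, hm⟩ := model_pair k v₀ w₀ hvL hwL hv2 hw2 hdv hdw
  have hm' : AB k w₀ v₀ = 2 * (m : ℚ) := by rw [hs, hm]
  have hm2 : m = 1 ∨ m = -1 := by
    have := hnegdef 1 m (by simp)
    rw [hF] at this
    simp [hv2, hw2, hm, hm'] at this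
    have h2 : ((m * m : ℤ) : ℚ) < (2 : ℤ) := by push_cast; linarith
    have h3 : m * m < 2 := by exact_mod_cast h2
    have h4 : m < 2 := by nlinarith
    have h5 : -2 < m := by nlinarith
    obtain ⟨t, rfl⟩ := hmo
    omega
  have hmm : m * m = 1 := by rcases hm2 with rfl | rfl <;> norm_num
  have hmq : (m : ℚ) * m = 1 := by exact_mod_cast hmm
  refine ⟨?_, (m : ℚ) • Ψ w₀, ?_, ?_, ?_, ?_, ?_, ?_, ?_⟩
  · rw [hΨ, hm]; rcases hm2 with rfl | rfl <;> norm_num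
  · rcases hm2 with rfl | rfl <;> simp
  · rw [hF]; simp [hm]; linear_combination 2 * hmq
  · rw [hF]; simp [hv2, hw2, hm, hm']; linear_combination 2 * hmq
  · rw [hF]; simp [hw2, hm]; right; ring
  · refine ⟨Ψ.toLinearMap ∘ₗ
      (((1 / 2 : ℚ) • (LinearMap.proj (R := ℚ) (φ := fun _ : Fin 2 => ℚ) 0 +
        LinearMap.proj (R := ℚ) (φ := fun _ : Fin 2 => ℚ) 1)).smulRight v₀ +
        ((m : ℚ) • (LinearMap.proj (R := ℚ) (φ := fun _ : Fin 2 => ℚ) 0)).smulRight w₀), ?_, ?_, ?_⟩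
    · rw [injective_iff_map_eq_zero]
      intro x hx
      have := hindep ((1 / 2 : ℚ) * (x 0 + x 1)) (m * x 0) (by simpa [mul_add] using hx)
      have h0 : x 0 = 0 := by linear_combination m * this.2 - x 0 * hmq
      have h1 : x 1 = 0 := by linear_combination 2 * this.1 - h0
      funext i; fin_cases i
      · exact h0
      · exact h1
    · intro x y
      rw [hF]
      simp [hv2, hw2, hm, hm', negE]
      linear_combination (x 0 * y 1 + x 1 * y 0) * hmq
    · ext z
      simp only [Set.mem_image, Set.mem_ofPred_eq, DSet]
      constructor
      · rintro ⟨x, ⟨h1, a, ha⟩, rfl⟩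
        obtain ⟨b, hb⟩ := h1 0
        refine ⟨a, m * b, ?_⟩
        simp only [Fin.sum_univ_two] at ha
        simp [hb]
        congr 1
        rw [← hb]; linarith
      · rintro ⟨a, b, rfl⟩
        refine ⟨![m * b, 2 * a - m * b], ⟨?_, a, ?_⟩, ?_⟩
        · intro i; fin_cases i
          · exact ⟨m * b, by simp⟩
          · exact ⟨2 * a - m * b, by simp⟩
        · simp
        · simp [← mul_assoc, hmq]
          congr 1
          ring
  · intro x hx
    rw [hM] at hx
    obtain ⟨x₀, rfl⟩ := Ψ.surjective x
    simp only [LinearEquiv.symm_apply_apply] at hx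
    obtain ⟨s, hs1⟩ := hdv x₀ hx
    obtain ⟨t, ht⟩ := hdw x₀ hx
    have hs1' : AB k x₀ v₀ = 2 * s := by rw [hs, hs1]
    have ht' : AB k x₀ w₀ = 2 * t := by rw [hs, ht]
    refine ⟨-(s + m * t), -(m * s + 2 * t),
      Ψ (x₀ + ((s + m * t : ℤ) : ℚ) • v₀ + ((m * s + 2 * t : ℤ) : ℚ) • w₀), ?_, ?_, ?_, ?_⟩
    · rw [hΨL]
      exact (LA k).add_mem ((LA k).add_mem hx (zsmul_mem_q _ hvL _ rfl)) (zsmul_mem_q _ hwL _ rfl)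
    · rw [hΨ]
      simp [hs1', hv2, hm']
      linear_combination 2 * s * hmq
    · rw [hΨ]
      simp [ht', hw2, hm]
      linear_combination 2 * t * hmq
    · rw [← map_smul, ← map_smul, ← map_add, ← map_add]
      congr 1
      push_cast; module
  · have hwm : (m : ℚ) • w₀ ∈ LA k := zsmul_mem_q _ hwL m rfl
    obtain ⟨g, hg1, hg2, hg3⟩ := model_main k ((m : ℚ) • w₀) (v₀ + (m : ℚ) • w₀) hwm
      ((LA k).add_mem hvL hwm) (by simp [hw2]; linear_combination 2 * hmq)
      (by simp [hv2, hw2, hm, hm']; linear_combination 2 * hmq)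
      (by simp [hw2, hm']; right; ring)
      (by
        intro y hy
        obtain ⟨n, hn⟩ := hdw y hy
        exact ⟨m * n, by simp [hn]; ring⟩)
      (by
        intro y hy
        obtain ⟨n, hn⟩ := hdw y hy
        obtain ⟨n', hn'⟩ := hdv y hy
        exact ⟨n' + m * n, by simp [hn, hn']; ring⟩)
    have hperp : ∀ z, (AB k z v₀ = 0 ∧ AB k z w₀ = 0) ↔ (g z).2.2 = 0 := by
      intro z
      have h1 : (AB k z v₀ = 0 ∧ AB k z w₀ = 0) ↔
          (AB k z ((m : ℚ) • w₀) = 0 ∧ AB k z (v₀ + (m : ℚ) • w₀) = 0) := by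
        have hm0 : (m : ℚ) ≠ 0 := fun h => by rw [h] at hmq; norm_num at hmq
        simp only [map_add, map_smul, smul_eq_mul]
        constructor
        · rintro ⟨h1, h2⟩; simp [h1, h2]
        · rintro ⟨h1, h2⟩
          rw [h1, add_zero] at h2
          exact ⟨h2, by simpa [hm0] using h1⟩
      have h2 : (AB k (aVec k) (g z) = 0 ∧ AB k (bVec k) (g z) = 0) ↔ (g z).2.2 = 0 := by
        rw [AB_a, AB_b]
        constructor
        · rintro ⟨h1, h2⟩
          funext i; fin_cases i
          · simp; linarith
          · simp; linarith
        · intro h; simp [h]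
      rw [h1, ← h2, ← hg1, ← hg1 z (v₀ + _), hs (g z), hs (g z)]
      rcases hg3 with ⟨h3, h4⟩ | ⟨h3, h4⟩
      · rw [h3, h4]
      · rw [h3, h4, and_comm]
    let ι : IIAmb k →ₗ[ℚ] AAmb k :=
      (LinearMap.fst ℚ _ _).prod ((LinearMap.snd ℚ _ _).prod 0)
    have hι : ∀ x, ι x = (x.1, x.2, 0) := fun x => rfl
    refine ⟨Ψ.toLinearMap ∘ₗ g.symm.toLinearMap ∘ₗ ι, ?_, ?_, ?_⟩
    · rw [injective_iff_map_eq_zero]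
      intro x hx
      have : ι x = 0 := by simpa using hx
      rw [hι] at this
      have h1 : x.1 = 0 := congrArg (fun z : AAmb k => z.1) this
      have h2 : x.2 = 0 := congrArg (fun z : AAmb k => z.2.1) this
      exact Prod.ext h1 h2
    · intro x y
      simp only [LinearMap.comp_apply, LinearEquiv.coe_coe]
      rw [hΨ, ← hg1]
      simp [hι, AB_apply, AForm, IIForm, negE_zero]
    · ext z
      obtain ⟨z, rfl⟩ := Ψ.surjective z
      simp only [Set.mem_image, Set.mem_ofPred_eq, LinearMap.comp_apply, LinearEquiv.coe_coe, hΨ, hΨL,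
        hperp]
      rw [← hg2]
      constructor
      · rintro ⟨x, ⟨h1, h2⟩, h⟩
        have h' := Ψ.injective h
        rw [← h']
        simp only [LinearEquiv.apply_symm_apply, hι]
        exact ⟨⟨h1, h2, IntVec.zero, 0, by simp⟩, trivial⟩
      · rintro ⟨⟨h1, h2, -⟩, h3⟩
        refine ⟨((g z).1, (g z).2.1), ⟨h1, h2⟩, ?_⟩
        have : ι ((g z).1, (g z).2.1) = g z := by
          rw [hι]; exact Prod.ext rfl (Prod.ext rfl h3.symm)
        rw [this]; simp

/-- Let `(Λ, ξ)` be a decorated `D`-lattice of dimension `N ≡ 4 (mod 8)`, `N = 8k+4`.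
If `v` is hyperelliptic (`v² = -4`, `div(v) = 2`, `v* = ξ`) and `w` is unigonal
(`w² = -2`, `div(w) = 2`), spanning a negative definite sublattice, then `|(v,w)| = 2`;
after possibly replacing `w` by `-w` so that `(v, w') = 2`, the pair `{v + w', w'}` is a
standard basis of `⟨v,w⟩ ≅ D₂ = A₁ ⊕ A₁`, and `Λ = ⟨v,w⟩ ⊕ ⟨v,w⟩^⊥` with
`⟨v,w⟩^⊥ ≅ II_{2,N-2} = U² ⊕ E₈^k`. -/
theorem statement12 (N : ℕ) (hN : 4 ≤ N) (hmod : N % 8 = 4)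
    (v w : Fin (N + 2) → ℚ)
    (hvL : v ∈ LamSet N) (hwL : w ∈ LamSet N)
    (hv2 : LamForm N v v = -4) (hw2 : LamForm N w w = -2)
    (hvdiv : HasDiv N v 2) (hwdiv : HasDiv N w 2)
    (hindep : ∀ a b : ℚ, a • v + b • w = 0 → a = 0 ∧ b = 0)
    (hnegdef : ∀ a b : ℚ, ¬(a = 0 ∧ b = 0) →
      LamForm N (a • v + b • w) (a • v + b • w) < 0) :
    (LamForm N v w = 2 ∨ LamForm N v w = -2) ∧
    ∃ w', (w' = w ∨ w' = -w) ∧ LamForm N v w' = 2 ∧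
      LamForm N (v + w') (v + w') = -2 ∧ LamForm N (v + w') w' = 0 ∧
      (∃ G : (Fin 2 → ℚ) →ₗ[ℚ] (Fin (N + 2) → ℚ),
        Function.Injective G ∧
        (∀ x y, LamForm N (G x) (G y) = negE x y) ∧
        G '' DSet 2 = {z | ∃ a b : ℤ, z = (a : ℚ) • v + (b : ℚ) • w}) ∧
      (∀ x ∈ LamSet N, ∃ a b : ℤ, ∃ y, y ∈ LamSet N ∧
        LamForm N y v = 0 ∧ LamForm N y w = 0 ∧
        x = (a : ℚ) • v + (b : ℚ) • w + y) ∧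
      (∃ F : IIAmb (N / 8) →ₗ[ℚ] (Fin (N + 2) → ℚ),
        Function.Injective F ∧
        (∀ x y, LamForm N (F x) (F y) = IIForm (N / 8) x y) ∧
        F '' IISet (N / 8) =
          {x | x ∈ LamSet N ∧ LamForm N x v = 0 ∧ LamForm N x w = 0}) := by
  obtain ⟨k, rfl⟩ : ∃ k, N = 8 * k + 4 := ⟨N / 8, by omega⟩
  rw [show (8 * k + 4) / 8 = k by omega]
  exact final_aux k v w hvL hwL hv2 hw2 hvdiv hwdiv hindep hnegdef
end
end

section
/- Let Λ be an even lattice of signature (2,N) containing U ⊕ U (Eichler's criterion): for primitive nonzero vectors v, w ∈ Λ, there exists g ∈ Õ⁺(Λ) with g(v) = w if and only if v² = w² and v* = w* in A_Λ. Consequently, in a decorated D-lattice (Λ,ξ) of dimension N ≥ 3: (a) all vectors with v² = -2, div(v) = 1 form a single Γ_ξ-orbit; (b) all vectors with v² = -4, div(v) = 2, v* = ξ form a single Γ_ξ-orbit. -/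
noncomputable section

open scoped BigOperators

/-- The determinant of the projection of `g` on the positive definite plane spanned by
the orthogonal positive vectors `p, q`; its positivity characterizes `O⁺`. -/
def posdet {V : Type*} (B : V → V → ℚ) (p q : V) (g : V → V) : ℚ :=
  B (g p) p * B (g q) q - B (g p) q * B (g q) p

/-- A positive norm vector of `Λ_N` supported on the first hyperbolic plane. -/
def pPos (N : ℕ) : Fin (N + 2) → ℚ := fun i => if (i : ℕ) = 0 ∨ (i : ℕ) = 1 then 1 else 0

/-- A positive norm vector of `Λ_N` supported on the second hyperbolic plane. -/
def qPos (N : ℕ) : Fin (N + 2) → ℚ := fun i => if (i : ℕ) = 2 ∨ (i : ℕ) = 3 then 1 else 0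

/-- `g ∈ Γ_ξ`: an isometry of the ambient space preserving `Λ_N`, lying in `O⁺` and
fixing the decoration `ξ`. -/
def InGamma (N : ℕ) (ξv : Fin (N + 2) → ℚ)
    (g : (Fin (N + 2) → ℚ) ≃ₗ[ℚ] (Fin (N + 2) → ℚ)) : Prop :=
  (∀ x y, LamForm N (g x) (g y) = LamForm N x y) ∧
  (∀ x, x ∈ LamSet N ↔ g x ∈ LamSet N) ∧
  0 < posdet (LamForm N) (pPos N) (qPos N) ⇑g ∧
  g ξv - ξv ∈ LamSet N


set_option linter.unusedSimpArgs false
set_option linter.unusedVariables false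
/-- Packaged data of an even lattice of signature `(2, *)` in a rational quadratic space. -/
structure EichData (V : Type) [AddCommGroup V] [Module ℚ V] where
  B : V →ₗ[ℚ] V →ₗ[ℚ] ℚ
  sym : ∀ x y, B x y = B y x
  L : AddSubgroup V
  int : ∀ x ∈ L, ∀ y ∈ L, ∃ a : ℤ, B x y = (a : ℚ)
  even : ∀ x ∈ L, ∃ a : ℤ, B x x = 2 * (a : ℚ)
  p : V
  q : V
  hp : 0 < B p p
  hq : 0 < B q q
  hpq : B p q = 0
  neg : ∀ x : V, B p x = 0 → B q x = 0 → x ≠ 0 → B x x < 0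

lemma quad_pos_det (A X Y C : ℚ)
    (h : ∀ s t : ℚ, (s ≠ 0 ∨ t ≠ 0) → 0 < s * s * A + s * t * (X + Y) + t * t * C) :
    0 < A * C - X * Y := by
  have hA : 0 < A := by simpa using h 1 0 (by simp)
  have h2 := h (-(X + Y)) (2 * A) (Or.inr (by positivity))
  have h3 : 0 < A * (4 * (A * C) - (X + Y) ^ 2) := by nlinarith
  have h4 := (mul_pos_iff_of_pos_left hA).1 h3
  nlinarith [sq_nonneg (X - Y)]

namespace EichData

variable {V : Type} [AddCommGroup V] [Module ℚ V] (D : EichData V)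

lemma nonpos (x : V) (h1 : D.B D.p x = 0) (h2 : D.B D.q x = 0) : D.B x x ≤ 0 := by
  by_cases hx : x = 0
  · simp [hx]
  · exact (D.neg x h1 h2 hx).le

/-- the pair spans a positive definite plane -/
def PosPair (a b : V) : Prop :=
  ∀ s t : ℚ, (s ≠ 0 ∨ t ≠ 0) → 0 < D.B (s • a + t • b) (s • a + t • b)

/-- Gram determinant of two pairs -/
def gd (a b c d : V) : ℚ := D.B a c * D.B b d - D.B a d * D.B b c

lemma gd_pos_normalized (a b c d : V) (h1 : D.PosPair a b) (h2 : D.PosPair c d)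
    (e1 : D.B a D.p = D.B c D.p) (e2 : D.B a D.q = D.B c D.q)
    (e3 : D.B b D.p = D.B d D.p) (e4 : D.B b D.q = D.B d D.q) : 0 < D.gd a b c d := by
  apply quad_pos_det
  intro s t hst
  have k1 := h1 s t hst
  have k2 := h2 s t hst
  have k3 := D.nonpos ((s • a + t • b) - (s • c + t • d))
    (by rw [D.sym]; simp [e1, e3]) (by rw [D.sym]; simp [e2, e4])
  simp only [map_add, map_sub, map_smul, LinearMap.add_apply, LinearMap.sub_apply,
    LinearMap.smul_apply, smul_eq_mul] at k1 k2 k3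
  rw [D.sym c a, D.sym c b, D.sym d a, D.sym d b] at k3
  nlinarith

lemma gd_ne (a b : V) (h : D.PosPair a b) : D.gd a b D.p D.q ≠ 0 := by
  intro h0
  have key : ∀ s t : ℚ, s * D.B a D.p + t * D.B b D.p = 0 →
      s * D.B a D.q + t * D.B b D.q = 0 → s = 0 ∧ t = 0 := by
    intro s t k1 k2
    by_contra hst
    have := h s t (by tauto)
    have k3 := D.nonpos (s • a + t • b) (by rw [D.sym]; simpa using k1)
      (by rw [D.sym]; simpa using k2)
    linarith
  unfold gd at h0
  have r1 := key (D.B b D.q) (- D.B a D.q) (by linarith) (by ring)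
  have r2 := key (D.B b D.p) (- D.B a D.p) (by ring) (by linarith)
  have r3 := key 1 0 (by linarith [r2.2]) (by linarith [r1.2])
  exact one_ne_zero r3.1

lemma exists_norm (a b : V) (h : D.PosPair a b) : ∃ s t s' t' : ℚ,
    D.B (s • a + t • b) D.p = 1 ∧ D.B (s • a + t • b) D.q = 0 ∧
    D.B (s' • a + t' • b) D.p = 0 ∧ D.B (s' • a + t' • b) D.q = 1 ∧
    s * t' - t * s' = (D.gd a b D.p D.q)⁻¹ ∧ D.PosPair (s • a + t • b) (s' • a + t' • b) := by
  have hne := D.gd_ne a b h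
  set G := D.gd a b D.p D.q with hG
  have hG' : G = D.B a D.p * D.B b D.q - D.B a D.q * D.B b D.p := rfl
  have hdet : D.B b D.q / G * (D.B a D.p / G) - (-D.B a D.q / G) * (-D.B b D.p / G) = G⁻¹ := by
    field_simp
    linarith
  refine ⟨D.B b D.q / G, - D.B a D.q / G, - D.B b D.p / G, D.B a D.p / G, ?_, ?_, ?_, ?_, hdet, ?_⟩
  · simp only [map_add, map_smul, LinearMap.add_apply, LinearMap.smul_apply, smul_eq_mul]
    field_simp
    linarith
  · simp only [map_add, map_smul, LinearMap.add_apply, LinearMap.smul_apply, smul_eq_mul]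
    field_simp
    ring
  · simp only [map_add, map_smul, LinearMap.add_apply, LinearMap.smul_apply, smul_eq_mul]
    field_simp
    ring
  · simp only [map_add, map_smul, LinearMap.add_apply, LinearMap.smul_apply, smul_eq_mul]
    field_simp
    linarith
  · generalize D.B b D.q / G = s at *
    generalize - D.B a D.q / G = t at *
    generalize - D.B b D.p / G = s' at *
    generalize D.B a D.p / G = t' at *
    intro x y hxy
    have e : x • (s • a + t • b) + y • (s' • a + t' • b)
        = (x * s + y * s') • a + (x * t + y * t') • b := by module
    rw [e]
    apply h
    by_contra hcon
    push Not at hcon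
    have hne' : s * t' - t * s' ≠ 0 := by rw [hdet]; exact inv_ne_zero hne
    have hx : x * (s * t' - t * s') = 0 := by linear_combination t' * hcon.1 - s' * hcon.2
    have hy : y * (s * t' - t * s') = 0 := by linear_combination s * hcon.2 - t * hcon.1
    rcases hxy with hxy | hxy
    · exact hxy ((mul_eq_zero.1 hx).resolve_right hne')
    · exact hxy ((mul_eq_zero.1 hy).resolve_right hne')

lemma gd_sign (a b c d : V) (h1 : D.PosPair a b) (h2 : D.PosPair c d) :
    0 < D.gd a b c d * (D.gd a b D.p D.q)⁻¹ * (D.gd c d D.p D.q)⁻¹ := by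
  obtain ⟨s, t, s', t', k1, k2, k3, k4, k5, k6⟩ := D.exists_norm a b h1
  obtain ⟨u, v, u', v', l1, l2, l3, l4, l5, l6⟩ := D.exists_norm c d h2
  have := D.gd_pos_normalized _ _ _ _ k6 l6 (by rw [k1, l1]) (by rw [k2, l2])
    (by rw [k3, l3]) (by rw [k4, l4])
  rw [← k5, ← l5]
  convert this using 1
  unfold gd
  simp only [map_add, map_smul, LinearMap.add_apply, LinearMap.smul_apply, smul_eq_mul]
  ring

lemma posPair_pq : D.PosPair D.p D.q := by
  intro s t hst
  have := D.hp
  have := D.hq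
  have h3 := D.hpq
  have h4 := D.hpq
  rw [D.sym] at h4
  simp only [map_add, map_smul, LinearMap.add_apply, LinearMap.smul_apply, smul_eq_mul, h3, h4]
  rcases hst with h | h
  · have := mul_pos (mul_self_pos.2 h) D.hp
    have := mul_nonneg (mul_self_nonneg t) D.hq.le
    linarith
  · have := mul_pos (mul_self_pos.2 h) D.hq
    have := mul_nonneg (mul_self_nonneg s) D.hp.le
    linarith

def Isom (g : V ≃ₗ[ℚ] V) : Prop := ∀ x y, D.B (g x) (g y) = D.B x y

lemma Isom.symm {D : EichData V} {g : V ≃ₗ[ℚ] V} (h : D.Isom g) : D.Isom g⁻¹ := by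
  intro x y
  have := h (g⁻¹ x) (g⁻¹ y)
  rw [← LinearEquiv.mul_apply, ← LinearEquiv.mul_apply] at this
  simpa using this.symm

lemma Isom.mul {D : EichData V} {g h : V ≃ₗ[ℚ] V} (hg : D.Isom g) (hh : D.Isom h) :
    D.Isom (g * h) := by
  intro x y
  simp [LinearEquiv.mul_apply, hg _ _, hh _ _]

lemma Isom.pair {D : EichData V} {g : V ≃ₗ[ℚ] V} (h : D.Isom g) :
    D.PosPair (g D.p) (g D.q) := by
  intro s t hst
  rw [← map_smul, ← map_smul, ← map_add, h]
  exact D.posPair_pq s t hst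

def pd (g : V ≃ₗ[ℚ] V) : ℚ := D.gd (g D.p) (g D.q) D.p D.q

lemma Isom.adj {D : EichData V} {g : V ≃ₗ[ℚ] V} (h : D.Isom g) (x y : V) :
    D.B (g x) y = D.B x (g⁻¹ y) := by
  rw [← h x (g⁻¹ y), ← LinearEquiv.mul_apply]
  simp

lemma pd_inv {g : V ≃ₗ[ℚ] V} (h : D.Isom g) : D.pd g⁻¹ = D.pd g := by
  unfold pd gd
  rw [h.adj, h.adj, h.adj, h.adj, D.sym D.p, D.sym D.p, D.sym D.q, D.sym D.q]
  ring

lemma pd_mul {g h : V ≃ₗ[ℚ] V} (hg : D.Isom g) (hh : D.Isom h) :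
    0 < D.pd (g * h) * (D.pd g)⁻¹ * (D.pd h)⁻¹ := by
  have := D.gd_sign (h D.p) (h D.q) (g⁻¹ D.p) (g⁻¹ D.q) hh.pair hg.symm.pair
  have e : D.gd (h D.p) (h D.q) (g⁻¹ D.p) (g⁻¹ D.q) = D.pd (g * h) := by
    unfold pd gd
    simp only [LinearEquiv.mul_apply, hg.adj]
  rw [e] at this
  have e2 : D.gd (g⁻¹ D.p) (g⁻¹ D.q) D.p D.q = D.pd g := D.pd_inv hg
  rw [e2] at this
  unfold pd at *
  linarith

lemma pd_mul_pos {g h : V ≃ₗ[ℚ] V} (hg : D.Isom g) (hh : D.Isom h) (h1 : 0 < D.pd g)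
    (h2 : 0 < D.pd h) : 0 < D.pd (g * h) := by
  have := D.pd_mul hg hh
  have h3 := inv_pos.2 h1
  have h4 := inv_pos.2 h2
  rw [mul_assoc] at this
  exact (mul_pos_iff_of_pos_right (mul_pos h3 h4)).1 this

lemma pd_sq_pos {g : V ≃ₗ[ℚ] V} (hg : D.Isom g) : 0 < D.pd (g * g) := by
  have := D.pd_mul hg hg
  have hne : D.pd g ≠ 0 := D.gd_ne _ _ hg.pair
  rw [mul_assoc] at this
  exact (mul_pos_iff_of_pos_right (mul_self_pos.2 (inv_ne_zero hne))).1 this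

def Dual (x : V) : Prop := ∀ y ∈ D.L, ∃ a : ℤ, D.B x y = (a : ℚ)

/-- The group of stable isometries in O⁺. -/
def G : Subgroup (V ≃ₗ[ℚ] V) where
  carrier := {g | D.Isom g ∧ (∀ x, x ∈ D.L ↔ g x ∈ D.L) ∧
    (∀ x, D.Dual x → g x - x ∈ D.L) ∧ 0 < D.pd g}
  one_mem' := by
    refine ⟨fun x y => rfl, fun x => Iff.rfl, fun x _ => by simp, ?_⟩
    have h : D.B D.q D.p = 0 := by rw [D.sym]; exact D.hpq
    have := mul_pos D.hp D.hq
    simpa [pd, gd, D.hpq, h] using this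
  mul_mem' := by
    rintro g h ⟨g1, g2, g3, g4⟩ ⟨h1, h2, h3, h4⟩
    refine ⟨g1.mul h1, fun x => (h2 x).trans (g2 (h x)), fun x hx => ?_, D.pd_mul_pos g1 h1 g4 h4⟩
    have e : (g * h) x - x = g (h x - x) + (g x - x) := by
      simp [LinearEquiv.mul_apply]
    rw [e]
    exact D.L.add_mem ((g2 _).1 (h3 x hx)) (g3 x hx)
  inv_mem' := by
    rintro g ⟨g1, g2, g3, g4⟩
    have hi : ∀ x, g (g⁻¹ x) = x := fun x => by rw [← LinearEquiv.mul_apply]; simp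
    refine ⟨g1.symm, fun x => ?_, fun x hx => ?_, by rw [D.pd_inv g1]; exact g4⟩
    · rw [g2 (g⁻¹ x), hi]
    · rw [g2, map_sub, hi, ← neg_sub]
      exact D.L.neg_mem (g3 x hx)

/-- Eichler transvection as a linear map -/
def T0 (z a : V) : V →ₗ[ℚ] V :=
  LinearMap.id + (D.B z).smulRight a - (D.B a).smulRight z
    - (D.B a a / 2) • (D.B z).smulRight z

lemma T0_apply (z a x : V) : D.T0 z a x =
    x + D.B z x • a - D.B a x • z - (D.B a a / 2 * D.B z x) • z := by
  simp [T0, smul_smul]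

lemma T0_comp (z a b x : V) (hz : D.B z z = 0) (ha : D.B z a = 0) (hb : D.B z b = 0) :
    D.T0 z a (D.T0 z b x) = D.T0 z (a + b) x := by
  have ha' : D.B a z = 0 := by rw [D.sym]; exact ha
  have hb' : D.B b z = 0 := by rw [D.sym]; exact hb
  simp only [T0_apply, map_add, map_sub, map_smul, LinearMap.add_apply, smul_eq_mul, hz, ha, hb,
    ha', hb', D.sym b a]
  module

/-- Eichler transvection -/
def T (z a : V) (hz : D.B z z = 0) (ha : D.B z a = 0) : V ≃ₗ[ℚ] V :=
  LinearEquiv.ofLinearMap (D.T0 z a) (D.T0 z (-a))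
    (LinearMap.ext fun x => (D.T0_comp z a (-a) x hz ha (by simp [ha])).trans
      (by simp [T0_apply]))
    (LinearMap.ext fun x => (D.T0_comp z (-a) a x hz (by simp [ha]) ha).trans
      (by simp [T0_apply]))

lemma T_apply (z a : V) (hz : D.B z z = 0) (ha : D.B z a = 0) (x : V) : D.T z a hz ha x =
    x + D.B z x • a - D.B a x • z - (D.B a a / 2 * D.B z x) • z := D.T0_apply z a x

lemma T_isom (z a : V) (hz : D.B z z = 0) (ha : D.B z a = 0) : D.Isom (D.T z a hz ha) := by
  intro x y
  have ha' : D.B a z = 0 := by rw [D.sym]; exact ha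
  simp only [T_apply, map_add, map_sub, map_smul, LinearMap.add_apply, LinearMap.sub_apply,
    LinearMap.smul_apply, smul_eq_mul, hz, ha, ha', D.sym x z, D.sym x a]
  ring

lemma T_sq (z a : V) (hz : D.B z z = 0) (ha : D.B z a = 0) :
    D.T z a hz ha = D.T z ((1/2 : ℚ) • a) hz (by simp [ha]) * D.T z ((1/2 : ℚ) • a) hz (by simp [ha]) := by
  ext x
  have := D.T0_comp z ((1/2 : ℚ) • a) ((1/2 : ℚ) • a) x hz (by simp [ha]) (by simp [ha])
  have e : (1/2 : ℚ) • a + (1/2 : ℚ) • a = a := by module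
  rw [e] at this
  exact this.symm

lemma smulL (n : ℤ) {x : V} (hx : x ∈ D.L) : (n : ℚ) • x ∈ D.L := by
  rw [Int.cast_smul_eq_zsmul]
  exact D.L.zsmul_mem hx n

lemma T_dual (z a : V) (hz : D.B z z = 0) (ha : D.B z a = 0) (hzL : z ∈ D.L) (haL : a ∈ D.L)
    (x : V) (hx : D.Dual x) : D.T z a hz ha x - x ∈ D.L := by
  obtain ⟨m, hm⟩ := hx z hzL
  obtain ⟨n, hn⟩ := hx a haL
  obtain ⟨k, hk⟩ := D.even a haL
  rw [D.sym] at hm hn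
  have e : D.T z a hz ha x - x = (m : ℚ) • a - (n : ℚ) • z - ((k * m : ℤ) : ℚ) • z := by
    rw [T_apply, hm, hn, hk]
    push_cast
    module
  rw [e]
  exact D.L.sub_mem (D.L.sub_mem (D.smulL _ haL) (D.smulL _ hzL)) (D.smulL _ hzL)

lemma T_mem (z a : V) (hz : D.B z z = 0) (ha : D.B z a = 0) (hzL : z ∈ D.L) (haL : a ∈ D.L) :
    D.T z a hz ha ∈ D.G := by
  refine ⟨D.T_isom z a hz ha, fun x => ?_, D.T_dual z a hz ha hzL haL, ?_⟩
  · have key : ∀ b (hb : D.B z b = 0), b ∈ D.L → ∀ x ∈ D.L, D.T z b hz hb x ∈ D.L := by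
      intro b hb hbL x hx
      have := D.T_dual z b hz hb hzL hbL x (D.int x hx)
      simpa using D.L.add_mem this hx
    refine ⟨key a ha haL x, fun h => ?_⟩
    have := key (-a) (by simp [ha]) (D.L.neg_mem haL) _ h
    have e : D.T z (-a) hz (by simp [ha]) (D.T z a hz ha x) = x := by
      have := D.T0_comp z (-a) a x hz (by simp [ha]) ha
      refine this.trans ?_
      simp [T0_apply]
    rwa [e] at this
  · rw [T_sq]
    exact D.pd_sq_pos (D.T_isom _ _ _ _)

/-- A pair of orthogonal hyperbolic planes. -/
structure Quad (e f e' f' : V) : Prop where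
  eL : e ∈ D.L
  fL : f ∈ D.L
  eL' : e' ∈ D.L
  fL' : f' ∈ D.L
  ee : D.B e e = 0
  ff : D.B f f = 0
  ef : D.B e f = 1
  ee' : D.B e' e' = 0
  ff' : D.B f' f' = 0
  ef' : D.B e' f' = 1
  x1 : D.B e e' = 0
  x2 : D.B e f' = 0
  x3 : D.B f e' = 0
  x4 : D.B f f' = 0

variable {D}

lemma Quad.swap {e f e' f' : V} (Q : D.Quad e f e' f') : D.Quad e' f' e f := by
  obtain ⟨h1, h2, h3, h4, h5, h6, h7, h8, h9, h10, h11, h12, h13, h14⟩ := Q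
  exact ⟨h3, h4, h1, h2, h8, h9, h10, h5, h6, h7, by rwa [D.sym], by rwa [D.sym],
    by rwa [D.sym], by rwa [D.sym]⟩

lemma Quad.flip {e f e' f' : V} (Q : D.Quad e f e' f') : D.Quad f e e' f' := by
  obtain ⟨h1, h2, h3, h4, h5, h6, h7, h8, h9, h10, h11, h12, h13, h14⟩ := Q
  exact ⟨h2, h1, h3, h4, h6, h5, by rwa [D.sym], h8, h9, h10, h13, h14, h11, h12⟩

lemma Quad.move {e f e' f' : V} (Q : D.Quad e f e' f') :
    ∃ g ∈ D.G, g f' = e ∧ g e = - f' := by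
  have Q2 := Q.swap.flip
  have Q3 := Q.swap
  have h1 : D.B f' f = 0 := Q2.x2
  have h2 : D.B e' e = 0 := Q3.x1
  refine ⟨D.T f' f Q.ff' h1 * D.T e' e Q.ee' h2 * D.T f' f Q.ff' h1,
    mul_mem (mul_mem (D.T_mem _ _ _ _ Q.fL' Q.fL) (D.T_mem _ _ _ _ Q.eL' Q.eL))
      (D.T_mem _ _ _ _ Q.fL' Q.fL), ?_, ?_⟩
  all_goals
    simp only [LinearEquiv.mul_apply, T_apply, map_add, map_sub, map_smul, smul_eq_mul,
      Q.ee, Q.ff, Q.ef, Q.ee', Q.ff', Q.ef', Q.x1, Q.x2, Q.x3, Q.x4,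
      Q2.ef, Q2.x1, Q2.x2, Q2.x3, Q2.x4, Q3.x1, Q3.x2, Q3.x3, Q3.x4, Q.flip.ef]
    module

lemma Quad.flip' {e f e' f' : V} (Q : D.Quad e f e' f') : D.Quad e f f' e' := Q.swap.flip.swap

lemma Quad.move_neg {e f e' f' : V} (Q : D.Quad e f e' f') : ∃ g ∈ D.G, g f' = -e := by
  obtain ⟨k, hk, k1, k2⟩ := Q.swap.flip.swap.flip.swap.move
  exact ⟨k, hk, k2⟩

lemma Quad.move_f {e f e' f' : V} (Q : D.Quad e f e' f') : ∃ g ∈ D.G, g f = e := by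
  obtain ⟨g, hg, h1, h2⟩ := Q.flip.move
  obtain ⟨k, hk, k1⟩ := Q.move_neg
  exact ⟨k * g, mul_mem hk hg, by simp [LinearEquiv.mul_apply, h2, k1]⟩

lemma Quad.self_neg {e f e' f' : V} (Q : D.Quad e f e' f') : ∃ g ∈ D.G, g e = -e := by
  obtain ⟨g, hg, h1, h2⟩ := Q.move
  exact ⟨g * g, mul_mem hg hg, by simp [LinearEquiv.mul_apply, h2, h1]⟩

/-- value minimality -/
def MinVal (D : EichData V) (e v : V) (b : ℤ) : Prop :=
  ∀ g ∈ D.G, ∀ c : ℤ, D.B e (g v) = c → c.natAbs < b.natAbs → c = 0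

lemma MinVal.of_move {e v : V} {b : ℤ} (h : MinVal D e v b) {z : V} (hz : ∃ k ∈ D.G, k z = e)
    {g : V ≃ₗ[ℚ] V} (hg : g ∈ D.G) (c : ℤ) (hc : D.B z (g v) = c) (hlt : c.natAbs < b.natAbs) :
    c = 0 := by
  obtain ⟨k, hk, hkz⟩ := hz
  refine h (k * g) (mul_mem hk hg) c ?_ hlt
  rw [← hkz, LinearEquiv.mul_apply, hk.1, hc]

lemma divis1 {e f e' f' : V} (Q : D.Quad e f e' f') {v : V} {b : ℤ} (hb : 0 < b)
    (h : MinVal D e v b) {g : V ≃ₗ[ℚ] V} (hg : g ∈ D.G) (hgb : D.B e (g v) = b)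
    (c : ℤ) (hc : D.B f' (g v) = c) : b ∣ c := by
  have Q3 := Q.swap
  set t := D.T e (((-(c / b) : ℤ) : ℚ) • e') Q.ee (by simp [Q.x1]) with ht
  have htm : t ∈ D.G := D.T_mem _ _ _ _ Q.eL (D.smulL _ Q.eL')
  have h1 : D.B f' ((t * g) v) = ((c % b : ℤ) : ℚ) := by
    rw [LinearEquiv.mul_apply, ht, T_apply]
    simp only [map_add, map_sub, map_smul, smul_eq_mul, hgb, hc, Q3.x3, Q3.flip.ef]
    rw [Int.emod_def]
    push_cast
    ring
  have h2 := h.of_move (by obtain ⟨k, hk, hk1, -⟩ := Q.move; exact ⟨k, hk, hk1⟩)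
    (mul_mem htm hg) _ h1 (by
      have := Int.emod_lt_of_pos c hb
      have := Int.emod_nonneg c hb.ne'
      omega)
  exact Int.dvd_of_emod_eq_zero h2

lemma divis2 {e f e' f' : V} (Q : D.Quad e f e' f') {v : V} (hv : v ∈ D.L) {b : ℤ} (hb : 0 < b)
    (h : MinVal D e v b) {g : V ≃ₗ[ℚ] V} (hg : g ∈ D.G) (hgb : D.B e (g v) = b)
    (c : ℤ) (hc : D.B f (g v) = c) : b ∣ c := by
  have Q3 := Q.swap
  have hgv : g v ∈ D.L := (hg.2.1 v).1 hv
  obtain ⟨m, hm⟩ := D.int _ Q.fL' _ hgv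
  obtain ⟨n, hn⟩ := D.int _ Q.eL' _ hgv
  obtain ⟨k, rfl⟩ := divis1 Q hb h hg hgb m hm
  have hbn := divis1 Q.flip' hb h hg hgb n hn
  set t := D.T e (((-k : ℤ) : ℚ) • e') Q.ee (by simp [Q.x1]) with ht
  have htm : t ∈ D.G := D.T_mem _ _ _ _ Q.eL (D.smulL _ Q.eL')
  have hx : D.B f' f = 0 := Q3.flip.x2
  set r := D.T f' f Q.ff' hx with hr
  have hrm : r ∈ D.G := D.T_mem _ _ _ _ Q.fL' Q.fL
  have a1 : D.B e ((t * g) v) = b := by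
    rw [LinearEquiv.mul_apply, ht, T_apply]
    simp only [map_add, map_sub, map_smul, smul_eq_mul, hgb, Q.x1, Q.ee]
    ring
  have a2 : D.B f' ((t * g) v) = 0 := by
    rw [LinearEquiv.mul_apply, ht, T_apply]
    simp only [map_add, map_sub, map_smul, smul_eq_mul, hgb, hm, Q3.flip.x1, Q3.flip.ef]
    push_cast
    ring
  have a3 : D.B e' ((t * g) v) = n := by
    rw [LinearEquiv.mul_apply, ht, T_apply]
    simp only [map_add, map_sub, map_smul, smul_eq_mul, hgb, hn, Q3.x1, Q3.ee]
    ring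
  have a4 : D.B f ((t * g) v) = c + k * n := by
    rw [LinearEquiv.mul_apply, ht, T_apply]
    simp only [map_add, map_sub, map_smul, LinearMap.smul_apply, smul_eq_mul, hgb, hn, hc, Q.x3,
      Q.flip.ef, Q.ee']
    push_cast
    ring
  have b1 : D.B e ((r * (t * g)) v) = b := by
    rw [LinearEquiv.mul_apply, hr, T_apply]
    simp only [map_add, map_sub, map_smul, smul_eq_mul, a1, a2, Q.x2]
    ring
  have b2 : D.B e' ((r * (t * g)) v) = ((n - (c + k * n) : ℤ) : ℚ) := by
    rw [LinearEquiv.mul_apply, hr, T_apply]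
    simp only [map_add, map_sub, map_smul, smul_eq_mul, a2, a3, a4, Q.ef']
    push_cast
    ring
  have hd := divis1 Q.flip' hb h (mul_mem hrm (mul_mem htm hg)) b1 _ b2
  have : c = n - (n - (c + k * n)) - k * n := by ring
  rw [this]
  exact dvd_sub (dvd_sub hbn hd) (hbn.mul_left k)

lemma divis3 {e f e' f' : V} (Q : D.Quad e f e' f') {v : V} (hv : v ∈ D.L) {b : ℤ} (hb : 0 < b)
    (h : MinVal D e v b) {g : V ≃ₗ[ℚ] V} (hg : g ∈ D.G) (hgb : D.B e (g v) = b)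
    (x : V) (hx : x ∈ D.L) (hex : D.B e x = 0) (hfx : D.B f x = 0)
    (c : ℤ) (hc : D.B x (g v) = c) : b ∣ c := by
  have hgv : g v ∈ D.L := (hg.2.1 v).1 hv
  obtain ⟨m, hm⟩ := D.int _ Q.fL _ hgv
  have hbm := divis2 Q hv hb h hg hgb m hm
  obtain ⟨s, hs⟩ := D.even x hx
  set t := D.T e x Q.ee hex with ht
  have htm : t ∈ D.G := D.T_mem _ _ _ _ Q.eL hx
  have a1 : D.B e ((t * g) v) = b := by
    rw [LinearEquiv.mul_apply, ht, T_apply]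
    simp only [map_add, map_sub, map_smul, smul_eq_mul, hgb, hex, Q.ee]
    ring
  have a2 : D.B f ((t * g) v) = ((m - c - s * b : ℤ) : ℚ) := by
    rw [LinearEquiv.mul_apply, ht, T_apply]
    simp only [map_add, map_sub, map_smul, smul_eq_mul, hgb, hm, hfx, hc, hs, Q.flip.ef]
    push_cast
    ring
  have hd := divis2 Q hv hb h (mul_mem htm hg) a1 _ a2
  have : c = m - (m - c - s * b) - s * b := by ring
  rw [this]
  exact dvd_sub (dvd_sub hbm hd) (dvd_mul_left b s)

lemma Quad.decomp {e f e' f' : V} (Q : D.Quad e f e' f') {x : V} (hx : x ∈ D.L) :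
    ∃ (m n : ℤ) (y : V), y ∈ D.L ∧ D.B e y = 0 ∧ D.B f y = 0 ∧
      x = (m : ℚ) • e + (n : ℚ) • f + y := by
  obtain ⟨m, hm⟩ := D.int _ Q.fL _ hx
  obtain ⟨n, hn⟩ := D.int _ Q.eL _ hx
  refine ⟨m, n, x - ((m : ℚ) • e + (n : ℚ) • f), D.L.sub_mem hx
    (D.L.add_mem (D.smulL _ Q.eL) (D.smulL _ Q.fL)), ?_, ?_, by abel⟩
  · simp [hn, Q.ee, Q.ef]
  · simp [hm, Q.ff, Q.flip.ef]

lemma exists_ne {e f e' f' : V} (Q : D.Quad e f e' f') {v x : V} (hv : v ∈ D.L)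
    (hx : x ∈ D.L) (hvx : D.B v x ≠ 0) : ∃ g ∈ D.G, D.B e (g v) ≠ 0 := by
  by_contra hcon
  push Not at hcon
  have hf : ∀ g ∈ D.G, D.B f (g v) = 0 := by
    intro g hg
    obtain ⟨k, hk, hkf⟩ := Q.move_f
    have := hcon (k * g) (mul_mem hk hg)
    rwa [← hkf, LinearEquiv.mul_apply, hk.1] at this
  have he1 := hcon 1 (one_mem _)
  have hf1 := hf 1 (one_mem _)
  simp only [LinearEquiv.coe_one, id_eq] at he1 hf1
  obtain ⟨m, n, y, hy, hey, hfy, rfl⟩ := Q.decomp hx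
  have h2 := hf _ (D.T_mem e y Q.ee hey Q.eL hy)
  rw [T_apply] at h2
  simp only [map_add, map_sub, map_smul, smul_eq_mul, he1, hf1, hfy, Q.flip.ef] at h2
  apply hvx
  rw [D.sym]
  simp only [map_add, map_smul, LinearMap.add_apply, LinearMap.smul_apply, smul_eq_mul, he1, hf1]
  linarith

lemma exists_div {e f e' f' : V} (Q : D.Quad e f e' f') {v : V} (hv : v ∈ D.L) {d : ℤ}
    (hd : 0 < d) (h1 : ∀ x ∈ D.L, ∃ a : ℤ, D.B v x = (d : ℚ) * a) (h2 : ∃ x ∈ D.L, D.B v x = d) :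
    ∃ g ∈ D.G, D.B e (g v) = d := by
  classical
  obtain ⟨x, hx, hvx⟩ := h2
  have hex : ∃ n : ℕ, 0 < n ∧ ∃ g ∈ D.G, ∃ b : ℤ, D.B e (g v) = b ∧ b.natAbs = n := by
    obtain ⟨g, hg, hne⟩ := exists_ne Q hv hx (by rw [hvx]; exact_mod_cast hd.ne')
    obtain ⟨b, hb⟩ := D.int _ Q.eL _ ((hg.2.1 v).1 hv)
    refine ⟨b.natAbs, ?_, g, hg, b, hb, rfl⟩
    rw [hb] at hne
    have : b ≠ 0 := by exact_mod_cast hne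
    omega
  obtain ⟨hn0, g, hg, b, hb, hbn⟩ := Nat.find_spec hex
  have hmin' : MinVal D e v b := by
    intro k hk c hc hlt
    by_contra h0
    exact Nat.find_min hex (hbn ▸ hlt) ⟨by omega, k, hk, c, hc, rfl⟩
  have hbne : b ≠ 0 := by omega
  clear hbn hn0
  obtain ⟨g, hg, b, hb, hmin, hbpos⟩ :
      ∃ g ∈ D.G, ∃ b : ℤ, D.B e (g v) = b ∧ MinVal D e v b ∧ 0 < b := by
    rcases lt_or_gt_of_ne hbne with hlt | hgt
    · obtain ⟨k, hk, hke⟩ := Q.self_neg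
      refine ⟨k * g, mul_mem hk hg, -b, ?_, ?_, by omega⟩
      · have := hk.1 e (g v)
        rw [hke, hb] at this
        rw [LinearEquiv.mul_apply]
        push_cast
        rw [← this]
        simp
      · intro k hk c hc hlt
        exact hmin' k hk c hc (by simpa using hlt)
    · exact ⟨g, hg, b, hb, hmin', hgt⟩
  refine ⟨g, hg, ?_⟩
  have hgv := (hg.2.1 v).1 hv
  have hdb : d ∣ b := by
    have hi := (D.G.inv_mem hg)
    obtain ⟨a, ha⟩ := h1 (g⁻¹ e) ((hi.2.1 e).1 Q.eL)
    rw [← hg.1.adj, D.sym, hb] at ha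
    exact ⟨a, by exact_mod_cast ha⟩
  have hbd : b ∣ d := by
    have hgx := (hg.2.1 x).1 hx
    have e1 : D.B (g x) (g v) = d := by rw [hg.1, D.sym, hvx]
    obtain ⟨m, n, y, hy, hey, hfy, hxy⟩ := Q.decomp hgx
    rw [hxy] at e1
    obtain ⟨c, hc⟩ := D.int _ Q.fL _ hgv
    obtain ⟨c', hc'⟩ := D.int _ hy _ hgv
    have k1 := divis2 Q hv hbpos hmin hg hb c hc
    have k2 := divis3 Q hv hbpos hmin hg hb y hy hey hfy c' hc'
    simp only [map_add, map_smul, LinearMap.add_apply, LinearMap.smul_apply, smul_eq_mul, hb, hc,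
      hc'] at e1
    have e2 : m * b + n * c + c' = d := by exact_mod_cast e1
    rw [← e2]
    exact dvd_add (dvd_add (dvd_mul_left _ _) (k1.mul_left _)) k2
  rw [hb, Int.dvd_antisymm hbpos.le hd.le hbd hdb]

lemma final_step {e f e' f' : V} (Q : D.Quad e f e' f') {v w : V} {d : ℤ}
    (hd : 0 < d) (hv : D.B e v = d) (hw : D.B e w = d) (hn : D.B v v = D.B w w)
    (hvw : (d : ℚ)⁻¹ • v - (d : ℚ)⁻¹ • w ∈ D.L) : ∃ g ∈ D.G, g v = w := by
  have hd0 : (d : ℚ) ≠ 0 := by exact_mod_cast hd.ne'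
  obtain ⟨m, n, y, hy, hey, hfy, hxy⟩ := Q.decomp hvw
  have hn0 : (n : ℚ) = 0 := by
    have := congrArg (D.B e) hxy
    simp only [map_add, map_sub, map_smul, smul_eq_mul, hv, hw, Q.ee, Q.ef, hey] at this
    linarith
  have hvw2 : w = v - (d * m : ℚ) • e - (d : ℚ) • y := by
    have : (d : ℚ) • ((d : ℚ)⁻¹ • v - (d : ℚ)⁻¹ • w) = v - w := by
      rw [smul_sub, smul_inv_smul₀ hd0, smul_inv_smul₀ hd0]
    rw [hxy, hn0] at this
    have e2 : w = v - (v - w) := by abel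
    rw [e2, ← this]
    module
  refine ⟨D.T e (-y) Q.ee (by simp [hey]), D.T_mem _ _ _ _ Q.eL (D.L.neg_mem hy), ?_⟩
  have hye : D.B y e = 0 := by rw [D.sym]; exact hey
  rw [hvw2] at hn
  simp only [map_sub, map_smul, LinearMap.sub_apply, LinearMap.smul_apply, smul_eq_mul,
    D.sym v e, D.sym v y, hv, Q.ee, hey, hye] at hn
  have h3 : D.B y v = D.B y y / 2 * d - d * m := by
    have : (d : ℚ) * (D.B y v) = d * (D.B y y / 2 * d - d * m) := by linarith
    exact mul_left_cancel₀ hd0 this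
  rw [T_apply, hvw2]
  simp only [map_neg, LinearMap.neg_apply, hv, h3]
  module

lemma orbit_of {e f e' f' : V} (Q : D.Quad e f e' f') {v w : V} (hvL : v ∈ D.L) (hwL : w ∈ D.L)
    {d : ℤ} (hd : 0 < d) (hn : D.B v v = D.B w w)
    (h1 : ∀ x ∈ D.L, ∃ a : ℤ, D.B v x = (d : ℚ) * a) (h2 : ∃ x ∈ D.L, D.B v x = d)
    (h3 : ∀ x ∈ D.L, ∃ a : ℤ, D.B w x = (d : ℚ) * a) (h4 : ∃ x ∈ D.L, D.B w x = d)
    (hvw : (d : ℚ)⁻¹ • v - (d : ℚ)⁻¹ • w ∈ D.L) : ∃ g ∈ D.G, g v = w := by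
  have hd0 : (d : ℚ) ≠ 0 := by exact_mod_cast hd.ne'
  have hdual : ∀ u : V, (∀ x ∈ D.L, ∃ a : ℤ, D.B u x = (d : ℚ) * a) →
      D.Dual ((d : ℚ)⁻¹ • u) := by
    intro u hu y hy
    obtain ⟨a, ha⟩ := hu y hy
    exact ⟨a, by simp [ha, hd0]⟩
  obtain ⟨g, hg, hgv⟩ := exists_div Q hvL hd h1 h2
  obtain ⟨k, hk, hkw⟩ := exists_div Q hwL hd h3 h4
  have e1 := hg.2.2.1 _ (hdual v h1)
  have e2 := hk.2.2.1 _ (hdual w h3)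
  obtain ⟨t, ht, htv⟩ := final_step Q (v := g v) (w := k w) hd hgv hkw (by rw [hg.1, hk.1, hn]) (by
    have := D.L.sub_mem (D.L.add_mem e1 hvw) e2
    rw [map_smul, map_smul] at this
    convert this using 1
    abel)
  refine ⟨k⁻¹ * (t * g), mul_mem (D.G.inv_mem hk) (mul_mem ht hg), ?_⟩
  rw [LinearEquiv.mul_apply, LinearEquiv.mul_apply, htv, ← LinearEquiv.mul_apply]
  simp

lemma dvd_of_prim {v w : V} (hvL : v ∈ D.L) (hwL : w ∈ D.L) {d d' : ℤ} (hd : 0 < d) (hd' : 0 < d')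
    (hw : ∀ (m : ℤ) (y : V), y ∈ D.L → (m : ℚ) • y = w → m = 1 ∨ m = -1)
    (hvw : (d : ℚ)⁻¹ • v - (d' : ℚ)⁻¹ • w ∈ D.L) : d' ∣ d := by
  have hd0 : (d : ℚ) ≠ 0 := by exact_mod_cast hd.ne'
  have hd0' : (d' : ℚ) ≠ 0 := by exact_mod_cast hd'.ne'
  have h1 : ((d : ℚ) / d') • w ∈ D.L := by
    have := D.L.sub_mem hvL (D.smulL d hvw)
    rw [smul_sub, smul_inv_smul₀ hd0, smul_smul, sub_sub_cancel] at this
    exact this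
  obtain ⟨m, hm⟩ : ((Int.gcd d d' : ℤ)) ∣ d' := Int.gcd_dvd_right ..
  have hb := Int.gcd_eq_gcd_ab d d'
  have h2 : ((Int.gcd d d' : ℤ) / d' : ℚ) • w ∈ D.L := by
    have := D.L.add_mem (D.smulL (Int.gcdA d d') h1) (D.smulL (Int.gcdB d d') hwL)
    convert this using 1
    rw [smul_smul, ← add_smul]
    congr 1
    rw [hb]
    push_cast
    field_simp
  have hg := hw m _ h2 (by
    rw [smul_smul]
    have : (m : ℚ) * (((Int.gcd d d' : ℤ) : ℚ) / d') = 1 := by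
      rw [← mul_div_assoc, div_eq_one_iff_eq hd0']
      have : ((d' : ℤ) : ℚ) = ((Int.gcd d d' : ℤ) : ℚ) * m := by exact_mod_cast hm
      rw [this]; ring
    rw [this, one_smul])
  have hgd : ((Int.gcd d d' : ℤ)) ∣ d := Int.gcd_dvd_left ..
  rcases hg with rfl | rfl
  · rw [hm, mul_one]; exact hgd
  · rw [hm]; simpa using hgd

lemma exists_gen {v x : V} (hx : x ∈ D.L) (hv : v ∈ D.L) (hvx : D.B v x ≠ 0) :
    ∃ d : ℤ, 0 < d ∧ (∀ x ∈ D.L, ∃ a : ℤ, D.B v x = (d : ℚ) * a) ∧ ∃ x ∈ D.L, D.B v x = (d : ℚ) := by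
  let H : AddSubgroup ℤ :=
    { carrier := {a | ∃ x ∈ D.L, D.B v x = (a : ℚ)}
      zero_mem' := ⟨0, D.L.zero_mem, by simp⟩
      add_mem' := by
        rintro a b ⟨x, hx, hx'⟩ ⟨y, hy, hy'⟩
        exact ⟨x + y, D.L.add_mem hx hy, by simp [hx', hy']⟩
      neg_mem' := by
        rintro a ⟨x, hx, hx'⟩
        exact ⟨-x, D.L.neg_mem hx, by simp [hx']⟩ }
  obtain ⟨a, ha⟩ := Int.subgroup_cyclic H
  have hmem : ∀ b : ℤ, b ∈ H ↔ a ∣ b := by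
    intro b
    rw [ha, AddSubgroup.mem_closure_singleton]
    constructor
    · rintro ⟨n, rfl⟩
      exact ⟨n, by simp [mul_comm]⟩
    · rintro ⟨n, rfl⟩
      exact ⟨n, by simp [mul_comm]⟩
  have hane : a ≠ 0 := by
    rintro rfl
    obtain ⟨b, hb⟩ := D.int v hv x hx
    have : b ∈ H := ⟨x, hx, hb⟩
    rw [hmem, zero_dvd_iff] at this
    rw [this] at hb
    exact hvx (by simpa using hb)
  refine ⟨|a|, abs_pos.2 hane, fun y hy => ?_, (hmem |a|).2 ((dvd_abs a a).2 dvd_rfl)⟩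
  obtain ⟨b, hb⟩ := D.int v hv y hy
  have : b ∈ H := ⟨y, hy, hb⟩
  rw [hmem] at this
  obtain ⟨c, hc⟩ := (abs_dvd a b).2 this
  exact ⟨c, by rw [hb, hc]; push_cast; ring⟩

lemma criterion (hspan : Submodule.span ℚ (D.L : Set V) = ⊤)
    {e f e' f' : V} (Q : D.Quad e f e' f') (v w : V) (hvL : v ∈ D.L) (hwL : w ∈ D.L)
    (hv0 : v ≠ 0)
    (hv : ∀ (m : ℤ) (y : V), y ∈ D.L → (m : ℚ) • y = v → m = 1 ∨ m = -1)
    (hw : ∀ (m : ℤ) (y : V), y ∈ D.L → (m : ℚ) • y = w → m = 1 ∨ m = -1) :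
    (∃ g ∈ D.G, g v = w) ↔
        (D.B v v = D.B w w ∧
          ∃ dv dw : ℤ, 0 < dv ∧ 0 < dw ∧
            (∀ x ∈ D.L, ∃ a : ℤ, D.B v x = (dv : ℚ) * a) ∧ (∃ x ∈ D.L, D.B v x = (dv : ℚ)) ∧
            (∀ x ∈ D.L, ∃ a : ℤ, D.B w x = (dw : ℚ) * a) ∧ (∃ x ∈ D.L, D.B w x = (dw : ℚ)) ∧
            (dv : ℚ)⁻¹ • v - (dw : ℚ)⁻¹ • w ∈ D.L) := by
  constructor
  · rintro ⟨g, hg, rfl⟩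
    refine ⟨(hg.1 v v).symm, ?_⟩
    have hex : ∃ x ∈ D.L, D.B v x ≠ 0 := by
      by_contra hcon
      push Not at hcon
      have hz : D.B v = 0 := LinearMap.ext_on hspan (fun x hx => by simpa using hcon x hx)
      have h1 := D.neg v (by rw [D.sym, hz]; rfl) (by rw [D.sym, hz]; rfl) hv0
      rw [hz] at h1
      simp at h1
    obtain ⟨x, hx, hvx⟩ := hex
    obtain ⟨d, hd, hd1, y, hy, hd2⟩ := exists_gen hx hvL hvx
    have hd0 : (d : ℚ) ≠ 0 := by exact_mod_cast hd.ne'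
    refine ⟨d, d, hd, hd, hd1, ⟨y, hy, hd2⟩, fun z hz => ?_, ⟨g y, (hg.2.1 y).1 hy, ?_⟩, ?_⟩
    · rw [hg.1.adj]
      exact hd1 _ (((D.G.inv_mem hg).2.1 z).1 hz)
    · rw [hg.1, hd2]
    · have := hg.2.2.1 ((d : ℚ)⁻¹ • v) (by
        intro z hz
        obtain ⟨a, ha⟩ := hd1 z hz
        exact ⟨a, by simp [ha, hd0]⟩)
      rw [map_smul] at this
      simpa using D.L.neg_mem this
  · rintro ⟨hn, d, d', hd, hd', h1, h2, h3, h4, h5⟩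
    have k1 := dvd_of_prim hvL hwL hd hd' hw h5
    have k2 := dvd_of_prim hwL hvL hd' hd hv (by simpa using D.L.neg_mem h5)
    obtain rfl := Int.dvd_antisymm hd.le hd'.le k2 k1
    exact orbit_of Q hvL hwL hd hn h1 h2 h3 h4 h5

end EichData

section Lam

lemma exists_lam (N : ℕ) (hN : 3 ≤ N) : ∃ D : EichData (Fin (N + 2) → ℚ),
    (∀ x y, D.B x y = LamForm N x y) ∧ (D.L : Set (Fin (N + 2) → ℚ)) = LamSet N ∧
    D.p = pPos N ∧ D.q = qPos N ∧ ∃ e f e' f', D.Quad e f e' f' := by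
  have v0 : ((0 : Fin (N + 2)) : ℕ) = 0 := rfl
  have v1 : ((1 : Fin (N + 2)) : ℕ) = 1 := rfl
  have v2 : ((2 : Fin (N + 2)) : ℕ) = 2 :=
    Nat.mod_eq_of_lt (show 2 < N + 2 by omega)
  have v3 : ((3 : Fin (N + 2)) : ℕ) = 3 :=
    Nat.mod_eq_of_lt (show 3 < N + 2 by omega)
  have hadd : ∀ x y z, LamForm N (x + y) z = LamForm N x z + LamForm N y z := by
    intro x y z
    have : (∑ i : Fin (N + 2), (if 4 ≤ (i : ℕ) then (x + y) i * z i else 0)) =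
        (∑ i : Fin (N + 2), (if 4 ≤ (i : ℕ) then x i * z i else 0)) +
        (∑ i : Fin (N + 2), (if 4 ≤ (i : ℕ) then y i * z i else 0)) := by
      rw [← Finset.sum_add_distrib]
      refine Finset.sum_congr rfl fun i _ => ?_
      split_ifs <;> simp [add_mul]
    unfold LamForm
    rw [this]
    simp only [Pi.add_apply]
    ring
  have hsmul : ∀ (c : ℚ) x z, LamForm N (c • x) z = c * LamForm N x z := by
    intro c x z
    have : (∑ i : Fin (N + 2), (if 4 ≤ (i : ℕ) then (c • x) i * z i else 0)) =
        c * (∑ i : Fin (N + 2), (if 4 ≤ (i : ℕ) then x i * z i else 0)) := by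
      rw [Finset.mul_sum]
      refine Finset.sum_congr rfl fun i _ => ?_
      split_ifs <;> simp [mul_assoc]
    unfold LamForm
    rw [this]
    simp only [Pi.smul_apply, smul_eq_mul]
    ring
  have hsym : ∀ x y, LamForm N x y = LamForm N y x := by
    intro x y
    unfold LamForm
    simp only [mul_comm (x _) (y _)]
    ring
  let B : (Fin (N + 2) → ℚ) →ₗ[ℚ] (Fin (N + 2) → ℚ) →ₗ[ℚ] ℚ :=
    LinearMap.mk₂ ℚ (LamForm N) hadd hsmul
      (fun x y z => by rw [hsym, hadd, hsym y, hsym z]) (fun c x y => by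
        rw [hsym, hsmul, hsym y]; rfl)
  have hintegral : ∀ x ∈ LamSet N, ∀ y ∈ LamSet N, ∃ a : ℤ, LamForm N x y = (a : ℚ) := by
    rintro x ⟨hx, -⟩ y ⟨hy, -⟩
    choose a ha using hx
    choose b hb using hy
    refine ⟨a 0 * b 1 + a 1 * b 0 + a 2 * b 3 + a 3 * b 2
      - ∑ i : Fin (N + 2), (if 4 ≤ (i : ℕ) then a i * b i else 0), ?_⟩
    unfold LamForm
    simp only [ha, hb]
    push_cast
    rfl
  have heven : ∀ x ∈ LamSet N, ∃ a : ℤ, LamForm N x x = 2 * (a : ℚ) := by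
    rintro x ⟨hx, k, hk⟩
    choose a ha using hx
    have hd : (2 : ℤ) ∣ ∑ i : Fin (N + 2), (if 4 ≤ (i : ℕ) then a i * a i - a i else 0) := by
      refine Finset.dvd_sum fun i _ => ?_
      split_ifs
      · have := (Int.even_mul_pred_self (a i)).two_dvd
        rwa [mul_sub, mul_one] at this
      · simp
    obtain ⟨m, hm⟩ := hd
    have hm' : (∑ i : Fin (N + 2), (if 4 ≤ (i : ℕ) then x i * x i else 0)) = 2 * k + 2 * m := by
      rw [← hk]
      have : ((2 * m : ℤ) : ℚ) = 2 * m := by push_cast; ring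
      rw [← this, ← hm]
      push_cast
      rw [← Finset.sum_add_distrib]
      refine Finset.sum_congr rfl fun i _ => ?_
      split_ifs <;> simp [ha]
    refine ⟨a 0 * a 1 + a 2 * a 3 - k - m, ?_⟩
    unfold LamForm
    rw [hm']
    simp only [ha]
    push_cast
    ring
  let L : AddSubgroup (Fin (N + 2) → ℚ) :=
    { carrier := LamSet N
      zero_mem' := ⟨fun i => ⟨0, by simp⟩, 0, by simp⟩
      add_mem' := by
        rintro x y ⟨hx, k, hk⟩ ⟨hy, l, hl⟩
        refine ⟨fun i => ?_, k + l, ?_⟩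
        · obtain ⟨a, ha⟩ := hx i
          obtain ⟨b, hb⟩ := hy i
          exact ⟨a + b, by simp [ha, hb]⟩
        · push_cast
          rw [mul_add, ← hk, ← hl, ← Finset.sum_add_distrib]
          refine Finset.sum_congr rfl fun i _ => ?_
          split_ifs <;> simp
      neg_mem' := by
        rintro x ⟨hx, k, hk⟩
        refine ⟨fun i => ?_, -k, ?_⟩
        · obtain ⟨a, ha⟩ := hx i
          exact ⟨-a, by simp [ha]⟩
        · push_cast
          rw [mul_neg, ← hk, ← Finset.sum_neg_distrib]
          refine Finset.sum_congr rfl fun i _ => ?_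
          split_ifs <;> simp }
  have hp : ∀ y, LamForm N (pPos N) y = y 0 + y 1 := by
    intro y
    have : (∑ i : Fin (N + 2), (if 4 ≤ (i : ℕ) then pPos N i * y i else 0)) = 0 := by
      refine Finset.sum_eq_zero fun i _ => ?_
      split_ifs with h
      · rw [pPos, if_neg (by omega), zero_mul]
      · rfl
    unfold LamForm
    rw [this]
    simp only [pPos, v0, v1, v2, v3]
    norm_num
    ring
  have hq : ∀ y, LamForm N (qPos N) y = y 2 + y 3 := by
    intro y
    have : (∑ i : Fin (N + 2), (if 4 ≤ (i : ℕ) then qPos N i * y i else 0)) = 0 := by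
      refine Finset.sum_eq_zero fun i _ => ?_
      split_ifs with h
      · rw [qPos, if_neg (by omega), zero_mul]
      · rfl
    unfold LamForm
    rw [this]
    simp only [qPos, v0, v1, v2, v3]
    norm_num
    ring
  have hneg : ∀ x, LamForm N (pPos N) x = 0 → LamForm N (qPos N) x = 0 → x ≠ 0 →
      LamForm N x x < 0 := by
    intro x h1 h2 hx
    rw [hp] at h1
    rw [hq] at h2
    have e1 : x 1 = - x 0 := by linarith
    have e3 : x 3 = - x 2 := by linarith
    have hnn : ∀ i ∈ (Finset.univ : Finset (Fin (N + 2))),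
        0 ≤ (if 4 ≤ (i : ℕ) then x i * x i else 0) := by
      intro i _
      split_ifs
      · exact mul_self_nonneg _
      · exact le_rfl
    have hS := Finset.sum_nonneg hnn
    by_contra hcon
    apply hx
    have hform : LamForm N x x = - 2 * (x 0 * x 0) - 2 * (x 2 * x 2)
        - ∑ i : Fin (N + 2), (if 4 ≤ (i : ℕ) then x i * x i else 0) := by
      unfold LamForm
      rw [e1, e3]
      ring
    have q0 := mul_self_nonneg (x 0)
    have q2 := mul_self_nonneg (x 2)
    have z0 : x 0 = 0 := mul_self_eq_zero.1 (by linarith)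
    have z2 : x 2 = 0 := mul_self_eq_zero.1 (by linarith)
    have zS := (Finset.sum_eq_zero_iff_of_nonneg hnn).1 (by linarith)
    funext i
    by_cases hi : 4 ≤ (i : ℕ)
    · have := zS i (Finset.mem_univ i)
      rw [if_pos hi] at this
      exact mul_self_eq_zero.1 this
    · have : i = 0 ∨ i = 1 ∨ i = 2 ∨ i = 3 := by
        simp only [Fin.ext_iff, v0, v1, v2, v3]
        omega
      rcases this with rfl | rfl | rfl | rfl
      · exact z0
      · rw [e1, z0]; simp
      · exact z2
      · rw [e3, z2]; simp
  let E : ℕ → (Fin (N + 2) → ℚ) := fun k i => if (i : ℕ) = k then 1 else 0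
  have hE : ∀ k < 4, ∀ y, LamForm N (E k) y =
      E k 0 * y 1 + E k 1 * y 0 + E k 2 * y 3 + E k 3 * y 2 := by
    intro k hk y
    have : (∑ i : Fin (N + 2), (if 4 ≤ (i : ℕ) then E k i * y i else 0)) = 0 := by
      refine Finset.sum_eq_zero fun i _ => ?_
      split_ifs with h
      · simp only [E]
        rw [if_neg (by omega), zero_mul]
      · rfl
    unfold LamForm
    rw [this, sub_zero]
  have hEL : ∀ k < 4, E k ∈ LamSet N := by
    intro k hk
    refine ⟨fun i => ⟨if (i : ℕ) = k then 1 else 0, by simp [E]⟩, 0, ?_⟩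
    rw [Finset.sum_eq_zero]
    · simp
    intro i _
    split_ifs with h
    · simp only [E]
      rw [if_neg (by omega)]
    · rfl
  refine ⟨⟨B, hsym, L, hintegral, heven, pPos N, qPos N, ?_, ?_, ?_, hneg⟩, fun x y => rfl, rfl, rfl, rfl,
    E 0, E 1, E 2, E 3, hEL 0 (by omega), hEL 1 (by omega), hEL 2 (by omega), hEL 3 (by omega),
    ?_, ?_, ?_, ?_, ?_, ?_, ?_, ?_, ?_, ?_⟩
  · change 0 < LamForm N _ _
    rw [hp]; simp [pPos, v0, v1]
  · change 0 < LamForm N _ _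
    rw [hq]; simp only [qPos, v2, v3]; norm_num
  · change LamForm N _ _ = 0
    rw [hp]; simp [qPos, v0, v1]
  all_goals
    refine (hE _ (by omega) _).trans ?_
    simp only [E, v0, v1, v2, v3]
    norm_num

lemma lam_orbit (N : ℕ) (hN : 3 ≤ N) (ξv : Fin (N + 2) → ℚ) (hξ : IsDeco N ξv)
    (v w : Fin (N + 2) → ℚ) (hv : v ∈ LamSet N) (hw : w ∈ LamSet N) (d : ℤ) (hd : 0 < d)
    (hn : LamForm N v v = LamForm N w w) (h1 : HasDiv N v d) (h2 : HasDiv N w d)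
    (h : (d : ℚ)⁻¹ • v - (d : ℚ)⁻¹ • w ∈ LamSet N) : ∃ g, InGamma N ξv g ∧ g v = w := by
  obtain ⟨D, hB, hL, hp, hq, e, f, e', f', Q⟩ := exists_lam N hN
  have hL' : ∀ x, x ∈ D.L ↔ x ∈ LamSet N := fun x => by rw [← hL]; rfl
  obtain ⟨g, hg, hgv⟩ := EichData.orbit_of Q (v := v) (w := w) ((hL' v).2 hv) ((hL' w).2 hw) hd
    (by simpa only [hB] using hn) (by simpa only [hB, hL'] using h1.1)
    (by simpa only [hB, hL'] using h1.2) (by simpa only [hB, hL'] using h2.1)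
    (by simpa only [hB, hL'] using h2.2) ((hL' _).2 h)
  obtain ⟨g1, g2, g3, g4⟩ := hg
  refine ⟨g, ⟨fun x y => by simpa only [hB] using g1 x y, fun x => by simpa only [hL'] using g2 x,
    ?_, ?_⟩, hgv⟩
  · unfold EichData.pd EichData.gd at g4
    simp only [hB, hp, hq] at g4
    exact g4
  · rw [← hL']
    apply g3
    intro y hy
    rw [hB]
    exact hξ.1 y ((hL' y).1 hy)

end Lam
/-- Eichler's criterion: for an even lattice `L` of signature `(2, N)` containing
`U ⊕ U`, two primitive nonzero vectors `v, w ∈ L` lie in the same `Õ⁺(L)`-orbit if and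
only if `v² = w²` and `v* = w*` in the discriminant group.  Consequently, in a decorated
`D`-lattice `(Λ_N, ξ)`: (a) the nodal vectors (`v² = -2`, `div(v) = 1`) form a single
`Γ_ξ`-orbit, and (b) the hyperelliptic vectors (`v² = -4`, `div(v) = 2`, `v* = ξ`) form
a single `Γ_ξ`-orbit. -/
theorem statement13 (N : ℕ) (hN : 3 ≤ N)
    (ξv : Fin (N + 2) → ℚ) (hξ : IsDeco N ξv) :
    (∀ (V : Type) (_ : AddCommGroup V), ∀ (_ : Module ℚ V), ∀ B : V → V → ℚ,
      (∀ x y z : V, B (x + y) z = B x z + B y z) →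
      (∀ (c : ℚ) (x y : V), B (c • x) y = c * B x y) →
      (∀ x y : V, B x y = B y x) →
      ∀ L : Set V, (0 : V) ∈ L → (∀ x ∈ L, ∀ y ∈ L, x - y ∈ L) →
      (∀ x ∈ L, ∀ y ∈ L, ∃ a : ℤ, B x y = (a : ℚ)) →
      (∀ x ∈ L, ∃ a : ℤ, B x x = 2 * (a : ℚ)) →
      Submodule.span ℚ L = ⊤ →
      (∃ e f e' f' : V, e ∈ L ∧ f ∈ L ∧ e' ∈ L ∧ f' ∈ L ∧
        B e e = 0 ∧ B f f = 0 ∧ B e f = 1 ∧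
        B e' e' = 0 ∧ B f' f' = 0 ∧ B e' f' = 1 ∧
        B e e' = 0 ∧ B e f' = 0 ∧ B f e' = 0 ∧ B f f' = 0) →
      ∀ p q : V, 0 < B p p → 0 < B q q → B p q = 0 →
      (∀ x : V, B p x = 0 → B q x = 0 → x ≠ 0 → B x x < 0) →
      ∀ v w : V, v ∈ L → w ∈ L → v ≠ 0 → w ≠ 0 →
      (∀ (m : ℤ) (y : V), y ∈ L → (m : ℚ) • y = v → m = 1 ∨ m = -1) →
      (∀ (m : ℤ) (y : V), y ∈ L → (m : ℚ) • y = w → m = 1 ∨ m = -1) →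
      ((∃ g : V ≃ₗ[ℚ] V,
          (∀ x y, B (g x) (g y) = B x y) ∧
          (∀ x, x ∈ L ↔ g x ∈ L) ∧
          (∀ x : V, (∀ y ∈ L, ∃ a : ℤ, B x y = (a : ℚ)) → g x - x ∈ L) ∧
          0 < posdet B p q ⇑g ∧ g v = w) ↔
        (B v v = B w w ∧
          ∃ dv dw : ℤ, 0 < dv ∧ 0 < dw ∧
            (∀ x ∈ L, ∃ a : ℤ, B v x = (dv : ℚ) * a) ∧ (∃ x ∈ L, B v x = (dv : ℚ)) ∧
            (∀ x ∈ L, ∃ a : ℤ, B w x = (dw : ℚ) * a) ∧ (∃ x ∈ L, B w x = (dw : ℚ)) ∧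
            (dv : ℚ)⁻¹ • v - (dw : ℚ)⁻¹ • w ∈ L))) ∧
    (∀ v w : Fin (N + 2) → ℚ, v ∈ LamSet N → w ∈ LamSet N →
      LamForm N v v = -2 → LamForm N w w = -2 →
      (∃ x ∈ LamSet N, LamForm N v x = 1) → (∃ x ∈ LamSet N, LamForm N w x = 1) →
      ∃ g, InGamma N ξv g ∧ g v = w) ∧
    (∀ v w : Fin (N + 2) → ℚ, v ∈ LamSet N → w ∈ LamSet N →
      LamForm N v v = -4 → LamForm N w w = -4 →
      HasDiv N v 2 → HasDiv N w 2 →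
      (1/2 : ℚ) • v - ξv ∈ LamSet N → (1/2 : ℚ) • w - ξv ∈ LamSet N →
      ∃ g, InGamma N ξv g ∧ g v = w) := by
  refine ⟨?_, ?_, ?_⟩
  · intro V _ _ B hadd hsmul hsym L h0 hsub hintegral heven hspan hU p q hp hq hpq hneg v w hv hw hv0 hw0
      hpv hpw
    obtain ⟨e, f, e', f', eL, fL, eL', fL', h5, h6, h7, h8, h9, h10, h11, h12, h13, h14⟩ := hU
    have hn : ∀ x ∈ L, -x ∈ L := fun x hx => by simpa using hsub 0 h0 x hx
    let D : EichData V :=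
      { B := LinearMap.mk₂ ℚ B hadd hsmul
          (fun x y z => by rw [hsym, hadd, hsym y, hsym z]) (fun c x y => by
            rw [hsym, hsmul, hsym y]; rfl)
        sym := hsym
        L :=
          { carrier := L
            zero_mem' := h0
            add_mem' := fun {x y} hx hy => by simpa using hsub x hx (-y) (hn y hy)
            neg_mem' := fun {x} hx => hn x hx }
        int := hintegral
        even := heven
        p := p
        q := q
        hp := hp
        hq := hq
        hpq := hpq
        neg := hneg }
    have Q : D.Quad e f e' f' :=
      ⟨eL, fL, eL', fL', h5, h6, h7, h8, h9, h10, h11, h12, h13, h14⟩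
    refine Iff.trans ?_ (EichData.criterion (D := D) hspan Q v w hv hw hv0 hpv hpw)
    constructor
    · rintro ⟨g, g1, g2, g3, g4, g5⟩
      exact ⟨g, ⟨g1, g2, g3, g4⟩, g5⟩
    · rintro ⟨g, ⟨g1, g2, g3, g4⟩, g5⟩
      exact ⟨g, g1, g2, g3, g4, g5⟩
  · intro v w hv hw hv2 hw2 hv1 hw1
    obtain ⟨D, hB, hL, -⟩ := exists_lam N hN
    have hL' : ∀ x, x ∈ D.L ↔ x ∈ LamSet N := fun x => by rw [← hL]; rfl
    have hdiv : ∀ u ∈ LamSet N, ∀ x ∈ LamSet N, ∃ a : ℤ, LamForm N u x = ((1 : ℤ) : ℚ) * a := by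
      intro u hu x hx
      obtain ⟨a, ha⟩ := D.int u ((hL' u).2 hu) x ((hL' x).2 hx)
      exact ⟨a, by rw [← hB, ha]; simp⟩
    refine lam_orbit N hN ξv hξ v w hv hw 1 one_pos (by rw [hv2, hw2])
      ⟨hdiv v hv, by simpa using hv1⟩ ⟨hdiv w hw, by simpa using hw1⟩ ?_
    have := D.L.sub_mem ((hL' v).2 hv) ((hL' w).2 hw)
    simpa using (hL' _).1 this
  · intro v w hv hw hv2 hw2 hv1 hw1 h1 h2
    obtain ⟨D, hB, hL, -⟩ := exists_lam N hN
    have hL' : ∀ x, x ∈ D.L ↔ x ∈ LamSet N := fun x => by rw [← hL]; rfl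
    refine lam_orbit N hN ξv hξ v w hv hw 2 two_pos (by rw [hv2, hw2]) hv1 hw1 ?_
    have := D.L.sub_mem ((hL' _).2 h1) ((hL' _).2 h2)
    rw [sub_sub_sub_cancel_right, hL'] at this
    simpa using this
end
end
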